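/- arXiv:1507.00380 — 2 statements merged into one kernel-verified Lean document; each statement's English description precedes it below -/
import Mathlib

section
/- Let Δ be a matroid on [s] of dimension s−1−c, let n ≥ c, and let f_1,…,f_s ∈ R = k[x_0,…,x_n] be homogeneous polynomials such that every subset of at most c+1 of them is an R-regular sequence. Then for every positive integer m: φ_*(I_Δ)^{(m)} = ⋂_{F a basis of Δ} (f_i : i ∈ [s]\F)^m = φ_*(I_Δ^{(m)}), where I_Δ^{(m)} = ⋂_{F a basis of Δ} P_F^m. In particular, φ_*(I_Δ)^{(m)} is generated by monomials in the f_i and has height c. -/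
/- ------------------------------------------------------------------
   Common definitions
------------------------------------------------------------------ -/

open MvPolynomial CategoryTheory

noncomputable section

/-- The height of an ideal: the infimum of the heights of the prime ideals containing it. -/
noncomputable def idealHeight {A : Type*} [CommRing A] (I : Ideal A) : ℕ∞ :=
  ⨅ P ∈ {P : PrimeSpectrum A | I ≤ P.asIdeal}, Order.height P

/-- The depth of a module `M` with respect to an ideal `J`: the supremum of the lengths of
`M`-regular sequences consisting of elements of `J`. -/
noncomputable def idealDepth {A : Type*} [CommRing A] (J : Ideal A)
    (M : Type*) [AddCommGroup M] [Module A M] : ℕ∞ :=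
  sSup {n : ℕ∞ | ∃ rs : List A, (rs.length : ℕ∞) = n ∧ (∀ r ∈ rs, r ∈ J) ∧
    RingTheory.Sequence.IsRegular M rs}

/-- The irrelevant maximal ideal `(x_i : i ∈ σ)` of the polynomial ring `k[x_i : i ∈ σ]`. -/
def irrelevantIdeal (k : Type) [Field k] (σ : Type) : Ideal (MvPolynomial σ k) :=
  Ideal.span (Set.range (X : σ → MvPolynomial σ k))

/-- The quotient of a polynomial ring by an ideal `I` is Cohen–Macaulay if its depth with
respect to the irrelevant maximal ideal equals its Krull dimension. -/
def IsCMQuotient {k : Type} [Field k] {σ : Type} (I : Ideal (MvPolynomial σ k)) : Prop :=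
  (idealDepth (irrelevantIdeal k σ) (MvPolynomial σ k ⧸ I) : WithBot ℕ∞)
    = ringKrullDim (MvPolynomial σ k ⧸ I)

/-- An ideal of a polynomial ring is homogeneous if it contains all homogeneous components
of each of its elements. -/
def IsHomogeneousIdeal {k : Type} [Field k] {σ : Type} (I : Ideal (MvPolynomial σ k)) : Prop :=
  ∀ p ∈ I, ∀ i : ℕ, homogeneousComponent i p ∈ I

/-- The Hilbert function of `R/I`, `t ↦ dim_k [R/I]_t`, as a function `ℤ → ℤ`
(equal to `0` in negative degrees). -/
noncomputable def hilbertFn (k : Type) [Field k] {σ : Type} (I : Ideal (MvPolynomial σ k))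
    (t : ℤ) : ℤ :=
  if t < 0 then 0
  else
    (Module.finrank k (homogeneousSubmodule σ k t.toNat) : ℤ) -
    (Module.finrank k
      ((Submodule.restrictScalars k (I : Submodule (MvPolynomial σ k) (MvPolynomial σ k))) ⊓
        homogeneousSubmodule σ k t.toNat : Submodule k (MvPolynomial σ k)) : ℤ)

/-- `P` is the Hilbert polynomial of `R/I` if it agrees with the Hilbert function of `R/I`
in all sufficiently large degrees. -/
def IsHilbertPolyOf (k : Type) [Field k] {σ : Type} (I : Ideal (MvPolynomial σ k))
    (P : Polynomial ℚ) : Prop :=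
  ∃ N : ℤ, ∀ t : ℤ, N ≤ t → (hilbertFn k I t : ℚ) = P.eval (t : ℚ)

open Classical in
/-- The Hilbert polynomial of `R/I` (defined as `0` if none exists). -/
noncomputable def hilbertPoly (k : Type) [Field k] {σ : Type} (I : Ideal (MvPolynomial σ k)) :
    Polynomial ℚ :=
  if h : ∃ P : Polynomial ℚ, IsHilbertPolyOf k I P then h.choose else 0

/-- The multiplicity (degree) `e(R/I)`: `(δ-1)!` times the leading coefficient of the Hilbert
polynomial of `R/I`, whose degree is `δ - 1` where `δ = dim R/I ≥ 1`. -/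
noncomputable def multiplicityDeg (k : Type) [Field k] {σ : Type}
    (I : Ideal (MvPolynomial σ k)) : ℚ :=
  (Nat.factorial (hilbertPoly k I).natDegree) * (hilbertPoly k I).leadingCoeff

/-- The `m`-th symbolic power of an ideal `J`:
`J^{(m)} = ⋂_{P ∈ Ass(A/J)} (J^m A_P ∩ A)`. -/
noncomputable def symbolicPower {A : Type*} [CommRing A] (J : Ideal A) (m : ℕ) : Ideal A :=
  sInf { K : Ideal A | ∃ (P : Ideal A) (hP : IsAssociatedPrime P (A ⧸ J)),
    K = Ideal.comap (algebraMap A (Localization (@Ideal.primeCompl A _ P hP.1)))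
          (Ideal.map (algebraMap A (Localization (@Ideal.primeCompl A _ P hP.1))) (J ^ m)) }

/-- `α(I)`: the least degree of a nonzero form in `I`. -/
noncomputable def alphaDeg (k : Type) [Field k] {σ : Type} (I : Ideal (MvPolynomial σ k)) : ℕ :=
  sInf {d : ℕ | ∃ p ∈ I, p ≠ 0 ∧ MvPolynomial.IsHomogeneous p d}

/-- `dim_k Tor_i^A(M, N)`, the rank over the base field `k` of the Tor module. -/
noncomputable def torRank (k : Type) [Field k] (A : Type) [CommRing A] [Algebra k A]
    (M N : Type) [AddCommGroup M] [Module A M] [AddCommGroup N] [Module A N] (i : ℕ) :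
    Cardinal :=
  Module.rank k (RestrictScalars k A
    (((Tor (ModuleCat A) i).obj (ModuleCat.of A M)).obj (ModuleCat.of A N)))

/-- The `i`-th total Betti number `dim_k Tor_i(S/I, k)` of `S/I`, where
`k = S/(x_i : i ∈ σ)`. -/
noncomputable def bettiNum (k : Type) [Field k] {σ : Type} (I : Ideal (MvPolynomial σ k))
    (i : ℕ) : Cardinal :=
  torRank k (MvPolynomial σ k) (MvPolynomial σ k ⧸ I)
    (MvPolynomial σ k ⧸ irrelevantIdeal k σ) i

/-- The first map `I_S → I_C ⊕ I_S`, `g ↦ (g, f·g)`, of the basic double linkage sequence. -/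
def bdlFirstMap {A : Type*} [CommRing A] {I_S I_C : Ideal A} (h : I_S ≤ I_C) (f : A) :
    I_S →ₗ[A] I_C × I_S :=
  LinearMap.prod (Submodule.inclusion h) (f • LinearMap.id)

/-- The second map `I_C ⊕ I_S → f·I_C + I_S`, `(a, b) ↦ f·a - b`, of the basic double
linkage sequence. -/
def bdlSecondMap {A : Type*} [CommRing A] (I_C I_S : Ideal A) (f : A) :
    I_C × I_S →ₗ[A] ↥(Ideal.span {f} * I_C + I_S) :=
  LinearMap.coprod
    (LinearMap.codRestrict ((Ideal.span {f} * I_C + I_S : Ideal A) : Submodule A A)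
      (f • (Submodule.subtype (I_C : Submodule A A)))
      (fun c => Submodule.mem_sup_left
        (Ideal.mul_mem_mul (Ideal.mem_span_singleton_self f) c.2)))
    (- LinearMap.codRestrict ((Ideal.span {f} * I_C + I_S : Ideal A) : Submodule A A)
      (Submodule.subtype (I_S : Submodule A A))
      (fun c => Submodule.mem_sup_right c.2))

/-- The ideal `I_{V_{λ,c}}` of the codimension-`c` configuration determined by `f_1, …, f_s`:
the intersection of the ideals `(f_{i_1}, …, f_{i_c})` over all `c`-subsets. -/
def configIdeal {A : Type*} [CommRing A] {s : ℕ} (c : ℕ) (f : Fin s → A) : Ideal A :=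
  ⨅ T ∈ {T : Finset (Fin s) | T.card = c}, Ideal.span (f '' ↑T)

/-- Every sublist of at most `m` of the elements `f 1, …, f s` (in any order, without
repetitions) is a regular sequence. -/
def SubsetsRegular {A : Type*} [CommRing A] {s : ℕ} (f : Fin s → A) (m : ℕ) : Prop :=
  ∀ l : List (Fin s), l.Nodup → l.length ≤ m →
    RingTheory.Sequence.IsRegular A (l.map f)

/-- `Δ` is (the independence complex of) a matroid on `{1, …, s}`: a nonempty collection of
subsets closed under inclusion and satisfying the augmentation axiom. -/
def IsMatroid {s : ℕ} (Δ : Finset (Fin s) → Prop) : Prop :=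
  Δ ∅ ∧ (∀ F G : Finset (Fin s), Δ F → G ⊆ F → Δ G) ∧
    (∀ F G : Finset (Fin s), Δ F → Δ G → G.card < F.card →
      ∃ j ∈ F, j ∉ G ∧ Δ (insert j G))

/-- `F` is a basis (facet) of the simplicial complex `Δ`: a maximal face. -/
def IsBasisOf {s : ℕ} (Δ : Finset (Fin s) → Prop) (F : Finset (Fin s)) : Prop :=
  Δ F ∧ ∀ G : Finset (Fin s), Δ G → F ⊆ G → G = F

/-- The Stanley–Reisner ideal of `Δ`, generated by the squarefree monomials corresponding
to the non-faces of `Δ`. -/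
def stanleyReisnerIdeal (k : Type) [Field k] {s : ℕ} (Δ : Finset (Fin s) → Prop) :
    Ideal (MvPolynomial (Fin s) k) :=
  Ideal.span
    ((fun F : Finset (Fin s) => ∏ i ∈ F, (X i : MvPolynomial (Fin s) k)) '' {F | ¬ Δ F})

/-- The ideal `I_{W_c}`: the intersection of all ideals `(A_{i_1,j_1}, …, A_{i_c,j_c})`
where `i_1 < ⋯ < i_c` and each generator is chosen from a different group. -/
def multiPartiteIdeal {A : Type*} [CommRing A] {s : ℕ} (c : ℕ) {e : Fin s → ℕ}
    (g : (i : Fin s) → Fin (e i) → A) : Ideal A :=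
  ⨅ T ∈ {T : Finset (Fin s) | T.card = c}, ⨅ j : (i : Fin s) → Fin (e i),
    Ideal.span ((fun i => g i (j i)) '' ↑T)

end

/-- The ideal generated by the members of the family `f` with index in `W`. -/
def familyIdeal {A ι : Type*} [CommRing A] (f : ι → A) (W : Finset ι) : Ideal A :=
  Ideal.span (f '' (W : Set ι))

/-- Multiplication by `t` is injective modulo the ideal `I`. -/
def IsRegularMod {A : Type*} [CommRing A] (I : Ideal A) (t : A) : Prop :=
  ∀ h, t * h ∈ I → h ∈ I

/-- Every member of the family `f` is regular modulo any set of at most `c` other members. -/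
def IsGenericFamily {A ι : Type*} [CommRing A] (f : ι → A) (c : ℕ) : Prop :=
  ∀ (W : Finset ι) (v : ι), v ∉ W → W.card ≤ c → IsRegularMod (familyIdeal f W) (f v)

section FamilyIdeal

variable {A ι : Type*} [CommRing A] {f : ι → A}

lemma mem_familyIdeal {W : Finset ι} {i : ι} (h : i ∈ W) : f i ∈ familyIdeal f W :=
  Ideal.subset_span ⟨i, h, rfl⟩

lemma familyIdeal_mono {V W : Finset ι} (h : V ⊆ W) : familyIdeal f V ≤ familyIdeal f W :=
  Ideal.span_mono (Set.image_mono (by exact_mod_cast h))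

lemma familyIdeal_empty : familyIdeal f ∅ = ⊥ := by
  simp [familyIdeal]

lemma monomial_mem_familyIdeal_pow {B : Finset ι} {w : ℕ} {e : ι →₀ ℕ}
    (h : w ≤ ∑ i ∈ B, e i) : (e.prod fun i t => f i ^ t) ∈ familyIdeal f B ^ w := by
  classical
  have h1 : ∏ i ∈ B, f i ^ e i ∈ familyIdeal f B ^ ∑ i ∈ B, e i := by
    rw [← Finset.prod_pow_eq_pow_sum]
    exact Ideal.prod_mem_prod fun i hi => Ideal.pow_mem_pow (mem_familyIdeal hi) _
  refine Ideal.mem_of_dvd _ ?_ (Ideal.pow_le_pow_right h h1)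
  rw [Finsupp.prod_of_support_subset e (Finset.subset_union_left (s₂ := B)) _ (by simp)]
  exact Finset.prod_dvd_prod_of_subset _ _ _ Finset.subset_union_right

variable [DecidableEq ι]

lemma familyIdeal_insert (v : ι) (W : Finset ι) :
    familyIdeal f (insert v W) = Ideal.span {f v} ⊔ familyIdeal f W := by
  simp [familyIdeal, Set.image_insert_eq, Ideal.span_insert]

lemma sup_pow_succ_le (x : A) (J : Ideal A) (w : ℕ) :
    (Ideal.span {x} ⊔ J) ^ (w + 1) ≤ Ideal.span {x} * (Ideal.span {x} ⊔ J) ^ w ⊔ J ^ (w + 1) := by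
  induction w with
  | zero => simp
  | succ w ih =>
    set I := Ideal.span {x} ⊔ J with hI
    calc I ^ (w + 1 + 1) = Ideal.span {x} * I ^ (w + 1) ⊔ J * I ^ (w + 1) := by
          rw [pow_succ' I (w + 1), ← Ideal.sup_mul]
      _ ≤ Ideal.span {x} * I ^ (w + 1) ⊔ J * (Ideal.span {x} * I ^ w ⊔ J ^ (w + 1)) := by
          gcongr
      _ ≤ Ideal.span {x} * I ^ (w + 1) ⊔ J ^ (w + 1 + 1) := by
          rw [Ideal.mul_sup, ← pow_succ' J (w + 1), ← sup_assoc]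
          gcongr
          refine sup_le le_rfl ?_
          rw [mul_left_comm, pow_succ' I w]
          gcongr
          exact le_sup_right

/-- Dividing by a generator lowers the exponent by one. -/
lemma mem_pow_sup_of_mul_mem {v : ι} {B W : Finset ι} {w : ℕ}
    (hreg : IsRegularMod (familyIdeal f B ^ (w + 1) ⊔ familyIdeal f W) (f v)) {h : A}
    (hh : f v * h ∈ familyIdeal f (insert v B) ^ (w + 1) ⊔ familyIdeal f W) :
    h ∈ familyIdeal f (insert v B) ^ w ⊔ familyIdeal f W := by
  have h1 : f v * h ∈ Ideal.span {f v} * familyIdeal f (insert v B) ^ w ⊔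
      (familyIdeal f B ^ (w + 1) ⊔ familyIdeal f W) := by
    rw [← sup_assoc]
    refine (sup_le_sup_right ?_ (familyIdeal f W) : _ ≤ _) hh
    rw [familyIdeal_insert]
    exact sup_pow_succ_le _ _ _
  obtain ⟨p, hp, r, hr, hpr⟩ := Submodule.mem_sup.1 h1
  obtain ⟨q, hq, rfl⟩ := Ideal.mem_span_singleton_mul.1 hp
  have h2 : h - q ∈ familyIdeal f B ^ (w + 1) ⊔ familyIdeal f W := by
    apply hreg
    rwa [mul_sub, ← hpr, add_sub_cancel_left]
  have h3 : familyIdeal f B ^ (w + 1) ⊔ familyIdeal f W ≤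
      familyIdeal f (insert v B) ^ w ⊔ familyIdeal f W := by
    refine sup_le_sup_right ?_ _
    exact (Ideal.pow_le_pow_right w.le_succ).trans
      (Ideal.pow_right_mono (familyIdeal_mono (Finset.subset_insert v B)) w)
  simpa using add_mem (h3 h2) (Ideal.mem_sup_left hq)

/-- An element that is regular modulo the ideal of a generic family is regular modulo the
powers of that ideal, also relative to further members of the family. -/
lemma IsGenericFamily.isRegularMod_pow_sup {c : ℕ} (hf : IsGenericFamily f c) (B W : Finset ι)
    (hBW : Disjoint B W) (hc : B.card + W.card ≤ c + 1) (w : ℕ) {t : A}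
    (ht : IsRegularMod (familyIdeal f (B ∪ W)) t) :
    IsRegularMod (familyIdeal f B ^ w ⊔ familyIdeal f W) t := by
  induction B using Finset.induction_on generalizing W w t with
  | empty =>
    cases w with
    | zero => intro h _; simp
    | succ w => simpa [familyIdeal_empty, Ideal.bot_pow] using ht
  | insert u B hu ihB =>
    rw [Finset.card_insert_of_notMem hu] at hc
    rw [Finset.disjoint_insert_left] at hBW
    induction w with
    | zero => intro h _; simp
    | succ w ihw =>
      intro h hh
      have hmod : familyIdeal f (insert u B) ^ (w + 1) ⊔ familyIdeal f W ≤
          familyIdeal f B ^ (w + 1) ⊔ familyIdeal f (insert u W) := by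
        rw [familyIdeal_insert u W]
        refine sup_le ?_ (le_sup_of_le_right le_sup_right)
        rw [familyIdeal_insert u B]
        refine (sup_pow_succ_le _ _ _).trans (sup_le ?_ le_sup_left)
        exact Ideal.mul_le_left.trans (le_sup_of_le_right le_sup_left)
      have h1 : h ∈ familyIdeal f B ^ (w + 1) ⊔ familyIdeal f (insert u W) := by
        refine ihB (insert u W) ?_ ?_ (w + 1) ?_ h (hmod hh)
        · exact Finset.disjoint_insert_right.2 ⟨hu, hBW.2⟩
        · rw [Finset.card_insert_of_notMem hBW.1]; omega
        · rwa [Finset.union_insert, ← Finset.insert_union]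
      rw [familyIdeal_insert, sup_comm (Ideal.span _), ← sup_assoc] at h1
      obtain ⟨q, hq, r, hr, rfl⟩ := Submodule.mem_sup.1 h1
      obtain ⟨h', rfl⟩ := Ideal.mem_span_singleton'.1 hr
      have hle : familyIdeal f B ^ (w + 1) ⊔ familyIdeal f W ≤
          familyIdeal f (insert u B) ^ (w + 1) ⊔ familyIdeal f W := by
        gcongr
        exact familyIdeal_mono (Finset.subset_insert u B)
      have h2 : f u * (t * h') ∈ familyIdeal f (insert u B) ^ (w + 1) ⊔ familyIdeal f W := by
        have := sub_mem hh (Ideal.mul_mem_left _ t (hle hq))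
        convert this using 1
        ring
      have hu' : IsRegularMod (familyIdeal f B ^ (w + 1) ⊔ familyIdeal f W) (f u) := by
        refine ihB W hBW.2 (by omega) (w + 1) (hf _ u ?_ ?_)
        · simp [hu, hBW.1]
        · rw [Finset.card_union_of_disjoint hBW.2]; omega
      have h3 := ihw h' (mem_pow_sup_of_mul_mem hu' h2)
      refine add_mem (hle hq) ?_
      obtain ⟨p, hp, q', hq', rfl⟩ := Submodule.mem_sup.1 h3
      rw [add_mul]
      refine add_mem (Ideal.mem_sup_left ?_) (Ideal.mem_sup_right (Ideal.mul_mem_right _ _ hq'))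
      rw [pow_succ]
      exact Ideal.mul_mem_mul hp (mem_familyIdeal (Finset.mem_insert_self u B))

end FamilyIdeal

section BaseFamily

variable {A ι : Type*} [CommRing A]

/-- The ideal generated by the monomials in the family `f` whose exponent vector, translated
by `a`, has degree at least `m` on each member of `ℬ`. -/
def shiftedMonomialIdeal (f : ι → A) (ℬ : Set (Finset ι)) (a : ι → ℕ) (m : ℕ) : Ideal A :=
  Ideal.span ((fun e : ι →₀ ℕ => e.prod fun i t => f i ^ t) ''
    {e | ∀ B ∈ ℬ, m ≤ ∑ i ∈ B, (a i + e i)})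

lemma shiftedMonomialIdeal_eq_top {f : ι → A} {ℬ : Set (Finset ι)} {a : ι → ℕ} {m : ℕ}
    (h : ∀ B ∈ ℬ, m ≤ ∑ i ∈ B, a i) : shiftedMonomialIdeal f ℬ a m = ⊤ := by
  rw [Ideal.eq_top_iff_one]
  exact Ideal.subset_span ⟨0, by simpa using h, by simp⟩

variable [DecidableEq ι]

/-- The exchange property of the bases of a matroid, in the form which prescribes the
element that enters the base. -/
def HasBaseExchange (ℬ : Set (Finset ι)) : Prop :=
  ∀ B ∈ ℬ, ∀ B' ∈ ℬ, ∀ v ∈ B', v ∉ B → ∃ u ∈ B, u ∉ B' ∧ insert v (B.erase u) ∈ ℬ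

/-- The contraction of a family of bases by the element `v`. -/
def baseContract (ℬ : Set (Finset ι)) (v : ι) : Set (Finset ι) :=
  {B | v ∉ B ∧ insert v B ∈ ℬ}

lemma HasBaseExchange.contract {ℬ : Set (Finset ι)} (h : HasBaseExchange ℬ) (v : ι) :
    HasBaseExchange (baseContract ℬ v) := by
  rintro B ⟨hvB, hB⟩ B' ⟨hvB', hB'⟩ x hx hxB
  have hxv : x ≠ v := fun e => hvB' (e ▸ hx)
  obtain ⟨u, hu, huB', hmem⟩ := h _ hB _ hB' x (Finset.mem_insert_of_mem hx) (by simp [hxv, hxB])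
  have huv : u ≠ v := fun e => huB' (by simp [e])
  refine ⟨u, Finset.mem_of_mem_insert_of_ne hu huv, fun e => huB' (by simp [e]), ?_, ?_⟩
  · simp [hxv.symm, hvB]
  · rwa [Finset.insert_comm, ← Finset.erase_insert_of_ne huv.symm]

lemma shiftedMonomialIdeal_contract_le {f : ι → A} {ℬ : Set (Finset ι)}
    (hℬ : HasBaseExchange ℬ) {a : ι → ℕ} {m : ℕ} {v : ι} {C : Finset ι} (hC : C ∈ ℬ) (hvC : v ∈ C)
    (hmin : ∀ B ∈ ℬ, ∀ u ∈ B, a v ≤ a u) :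
    shiftedMonomialIdeal f (baseContract ℬ v) a (m - a v) ≤ shiftedMonomialIdeal f ℬ a m := by
  refine Ideal.span_mono (Set.image_mono fun e he B hB => ?_)
  by_cases hvB : v ∈ B
  · have := he (B.erase v) ⟨Finset.notMem_erase v B, by rwa [Finset.insert_erase hvB]⟩
    rw [← Finset.add_sum_erase B _ hvB]
    omega
  · obtain ⟨u, hu, -, hmem⟩ := hℬ B hB C hC v hvC hvB
    have := he (B.erase u) ⟨fun h => hvB (Finset.mem_of_mem_erase h), hmem⟩
    rw [← Finset.add_sum_erase B _ hu]
    have := hmin B hB u hu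
    omega

lemma mul_mem_shiftedMonomialIdeal {f : ι → A} {ℬ : Set (Finset ι)} {a : ι → ℕ} {m : ℕ} {v : ι}
    {h : A} (hh : h ∈ shiftedMonomialIdeal f ℬ (a + Pi.single v 1) m) :
    f v * h ∈ shiftedMonomialIdeal f ℬ a m := by
  suffices shiftedMonomialIdeal f ℬ (a + Pi.single v 1) m ≤
      (shiftedMonomialIdeal f ℬ a m).colon {f v} by
    simpa [mul_comm] using Submodule.mem_colon_singleton.1 (this hh)
  refine Ideal.span_le.2 ?_
  rintro _ ⟨e, he, rfl⟩
  rw [SetLike.mem_coe, Submodule.mem_colon_singleton]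
  refine Ideal.subset_span ⟨e + Finsupp.single v 1, fun B hB => ?_, ?_⟩
  · refine (he B hB).trans (Finset.sum_le_sum fun i _ => ?_)
    by_cases hi : i = v
    · subst hi; simp; omega
    · simp [hi]
  · simp [Finsupp.prod_add_index', pow_add, mul_comm]

/-- Intersections of shifted powers of the ideals attached to the bases of a matroid are
generated by monomials in a generic family. -/
theorem IsGenericFamily.mem_shiftedMonomialIdeal [Fintype ι] {f : ι → A} {c : ℕ}
    (hf : IsGenericFamily f c) (r : ℕ) (ℬ : Set (Finset ι)) (hne : ℬ.Nonempty)
    (hℬ : HasBaseExchange ℬ) (hr : ∀ B ∈ ℬ, B.card = r) (W : Finset ι)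
    (hW : ∀ B ∈ ℬ, Disjoint B W) (hc : r + W.card ≤ c) (a : ι → ℕ) (m : ℕ) (g : A)
    (hg : ∀ B ∈ ℬ, g ∈ familyIdeal f B ^ (m - ∑ i ∈ B, a i) ⊔ familyIdeal f W) :
    g ∈ shiftedMonomialIdeal f ℬ a m ⊔ familyIdeal f W := by
  induction r generalizing ℬ W a m g with
  | zero =>
    obtain ⟨B, hB⟩ := hne
    obtain rfl := Finset.card_eq_zero.1 (hr B hB)
    cases m with
    | zero => rw [shiftedMonomialIdeal_eq_top (by simp)]; simp
    | succ m =>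
      have := hg _ hB
      simp only [Finset.sum_empty, familyIdeal_empty, Nat.sub_zero, Ideal.bot_pow m.succ_ne_zero,
        bot_sup_eq] at this
      exact Ideal.mem_sup_right this
  | succ r ih =>
    induction hN : ∑ i, (m - a i) using Nat.strong_induction_on generalizing a g with
    | _ N ihN =>
    obtain ⟨C₀, hC₀⟩ := hne
    obtain ⟨v, ⟨C, hC, hvC⟩, hv⟩ : ∃ v, (∃ C ∈ ℬ, v ∈ C) ∧ ∀ B ∈ ℬ, ∀ u ∈ B, a v ≤ a u := by
      classical
      have hne' : (Finset.univ.filter fun v => ∃ C ∈ ℬ, v ∈ C).Nonempty := by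
        obtain ⟨v, hv⟩ := Finset.card_pos.1 (by rw [hr C₀ hC₀]; omega : 0 < C₀.card)
        exact ⟨v, by simpa using ⟨C₀, hC₀, hv⟩⟩
      obtain ⟨v, hv, hmin⟩ := Finset.exists_min_image _ a hne'
      exact ⟨v, by simpa using hv, fun B hB u hu => hmin u (by simpa using ⟨B, hB, hu⟩)⟩
    by_cases hm : m ≤ a v
    · rw [shiftedMonomialIdeal_eq_top fun B hB => ?_]
      · simp
      obtain ⟨u, hu⟩ := Finset.card_pos.1 (by rw [hr B hB]; omega : 0 < B.card)
      exact hm.trans ((hv B hB u hu).trans (Finset.single_le_sum (fun _ _ => Nat.zero_le _) hu))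
    have hvW : v ∉ W := Finset.disjoint_left.1 (hW C hC) hvC
    -- reduction modulo `f v`
    have h1 : g ∈ shiftedMonomialIdeal f (baseContract ℬ v) a (m - a v) ⊔
        familyIdeal f (insert v W) := by
      refine ih (baseContract ℬ v) ⟨C.erase v, Finset.notMem_erase v C, ?_⟩ (hℬ.contract v) ?_
        (insert v W) ?_ ?_ a (m - a v) g ?_
      · rwa [Finset.insert_erase hvC]
      · rintro B ⟨hvB, hB⟩
        have := hr _ hB
        rw [Finset.card_insert_of_notMem hvB] at this
        omega
      · rintro B ⟨hvB, hB⟩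
        exact Finset.disjoint_insert_right.2
          ⟨hvB, (Finset.disjoint_insert_left.1 (hW _ hB)).2⟩
      · rw [Finset.card_insert_of_notMem hvW]; omega
      · rintro B ⟨hvB, hB⟩
        have hgB := hg _ hB
        rw [Finset.sum_insert hvB, ← Nat.sub_sub] at hgB
        rw [familyIdeal_insert v W]
        refine SetLike.le_def.1 ?_ hgB
        refine sup_le ?_ (le_sup_of_le_right le_sup_right)
        rw [familyIdeal_insert v B]
        cases m - a v - ∑ i ∈ B, a i with
        | zero => simp
        | succ w =>
          refine (sup_pow_succ_le _ _ _).trans (sup_le ?_ le_sup_left)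
          exact Ideal.mul_le_left.trans (le_sup_of_le_right le_sup_left)
    rw [familyIdeal_insert, sup_comm (Ideal.span _), ← sup_assoc] at h1
    obtain ⟨j, hj, y, hy, rfl⟩ := Submodule.mem_sup.1 h1
    obtain ⟨h, rfl⟩ := Ideal.mem_span_singleton'.1 hy
    have hj' : j ∈ shiftedMonomialIdeal f ℬ a m ⊔ familyIdeal f W := by
      refine SetLike.le_def.1 ?_ hj
      exact sup_le_sup_right (shiftedMonomialIdeal_contract_le hℬ hC hvC hv) _
    have hjB : ∀ B ∈ ℬ, j ∈ familyIdeal f B ^ (m - ∑ i ∈ B, a i) ⊔ familyIdeal f W := by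
      intro B hB
      refine SetLike.le_def.1 ?_ hj'
      refine sup_le_sup_right (Ideal.span_le.2 ?_) _
      rintro _ ⟨e, he, rfl⟩
      exact monomial_mem_familyIdeal_pow (by
        have := he B hB
        rw [Finset.sum_add_distrib] at this
        omega)
    have hh : ∀ B ∈ ℬ, f v * h ∈ familyIdeal f B ^ (m - ∑ i ∈ B, a i) ⊔ familyIdeal f W := by
      intro B hB
      simpa [mul_comm] using sub_mem (hg B hB) (hjB B hB)
    -- division by `f v`
    have h2 : h ∈ shiftedMonomialIdeal f ℬ (a + Pi.single v 1) m ⊔ familyIdeal f W := by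
      refine ihN _ ?_ (a + Pi.single v 1) h ?_ rfl
      · rw [← hN]
        refine Finset.sum_lt_sum (fun i _ => ?_) ⟨v, Finset.mem_univ v, ?_⟩
        · simp only [Pi.add_apply]; omega
        · simp only [Pi.add_apply, Pi.single_eq_same]; omega
      · intro B hB
        have hcard := hr B hB
        by_cases hvB : v ∈ B
        · have hsum : ∑ i ∈ B, (a + Pi.single v 1 : ι → ℕ) i = ∑ i ∈ B, a i + 1 := by
            simp [Finset.sum_add_distrib, Finset.sum_pi_single', hvB]
          rw [hsum]
          have hhB := hh B hB
          rw [← Nat.sub_sub]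
          obtain ⟨B, hvB', rfl⟩ : ∃ B', v ∉ B' ∧ insert v B' = B :=
            ⟨B.erase v, Finset.notMem_erase v B, Finset.insert_erase hvB⟩
          rw [Finset.card_insert_of_notMem hvB'] at hcard
          have hdisj := (Finset.disjoint_insert_left.1 (hW _ hB)).2
          generalize m - ∑ i ∈ insert v B, a i = w at hhB ⊢
          cases w with
          | zero => simp
          | succ w =>
            refine mem_pow_sup_of_mul_mem (hf.isRegularMod_pow_sup B W hdisj (by omega) _ ?_) hhB
            refine hf _ v (by simp [hvB', hvW]) ?_
            rw [Finset.card_union_of_disjoint hdisj]; omega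
        · have hsum : ∑ i ∈ B, (a + Pi.single v 1 : ι → ℕ) i = ∑ i ∈ B, a i := by
            simp [Finset.sum_add_distrib, Finset.sum_pi_single', hvB]
          rw [hsum]
          refine hf.isRegularMod_pow_sup B W (hW B hB) (by omega) _ (hf _ v ?_ ?_) h (hh B hB)
          · simp [hvB, hvW]
          · rw [Finset.card_union_of_disjoint (hW B hB)]; omega
    obtain ⟨p, hp, q, hq, rfl⟩ := Submodule.mem_sup.1 h2
    refine add_mem hj' ?_
    rw [mul_comm, mul_add]
    exact add_mem (Ideal.mem_sup_left (mul_mem_shiftedMonomialIdeal hp))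
      (Ideal.mem_sup_right (Ideal.mul_mem_left _ _ hq))

end BaseFamily

section SymbolicPower

variable {A ι : Type*} [CommRing A]

lemma IsRegularMod.prod {I : Ideal A} {f : ι → A} {W : Finset ι}
    (h : ∀ i ∈ W, IsRegularMod I (f i)) : IsRegularMod I (∏ i ∈ W, f i) := by
  classical
  induction W using Finset.induction_on with
  | empty => intro x hx; simpa using hx
  | insert v W hv ih =>
    intro x hx
    rw [Finset.prod_insert hv, mul_assoc] at hx
    exact ih (fun i hi => h i (Finset.mem_insert_of_mem hi)) x
      (h v (Finset.mem_insert_self v W) _ hx)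

/-- An ideal contained in no associated prime of `A ⧸ J` contains an element regular modulo `J`. -/
lemma exists_isRegularMod_of_not_le [IsNoetherianRing A] {J I : Ideal A}
    (h : ∀ P, IsAssociatedPrime P (A ⧸ J) → ¬ I ≤ P) : ∃ t ∈ I, IsRegularMod J t := by
  by_contra! hcon
  have hsub : (I : Set A) ⊆ ⋃ P ∈ associatedPrimes A (A ⧸ J), (P : Set A) := by
    intro t ht
    rw [biUnion_associatedPrimes_eq_zero_divisors]
    have := hcon t ht
    simp only [IsRegularMod, not_forall] at this
    obtain ⟨x, hx, hxJ⟩ := this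
    refine ⟨Ideal.Quotient.mk J x, by rwa [Ne, Ideal.Quotient.eq_zero_iff_mem], ?_⟩
    rw [Algebra.smul_def, Ideal.Quotient.algebraMap_eq, ← map_mul]
    exact Ideal.Quotient.eq_zero_iff_mem.2 hx
  obtain ⟨P, hP, hle⟩ := (Ideal.subset_union_prime_finite
    (associatedPrimes.finite A (A ⧸ J)) (f := id) ⊤ ⊤ fun P hP _ _ => hP.1).1 hsub
  exact h P hP hle

lemma mem_symbolicPower_iff {J : Ideal A} {m : ℕ} {g : A} :
    g ∈ symbolicPower J m ↔
      ∀ P, IsAssociatedPrime P (A ⧸ J) → ∃ t, t ∉ P ∧ t * g ∈ J ^ m := by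
  simp only [symbolicPower, Submodule.mem_sInf, Set.mem_ofPred_eq]
  constructor
  · intro h P hP
    have := hP.1
    have := h _ ⟨P, hP, rfl⟩
    rw [Ideal.mem_comap, IsLocalization.algebraMap_mem_map_algebraMap_iff P.primeCompl] at this
    exact this
  · rintro h _ ⟨P, hP, rfl⟩
    have := hP.1
    rw [Ideal.mem_comap, IsLocalization.algebraMap_mem_map_algebraMap_iff P.primeCompl]
    exact h P hP

variable [Fintype ι] [DecidableEq ι]

lemma prod_compl_mul_mem_iInf {f : ι → A} {c : ℕ} {ℬ : Set (Finset ι)}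
    (hcard : ∀ B ∈ ℬ, B.card = c) {B : Finset ι} (hB : B ∈ ℬ) {h : A} (hh : h ∈ familyIdeal f B) :
    (∏ i ∈ Bᶜ, f i) * h ∈ ⨅ B ∈ ℬ, familyIdeal f B := by
  simp only [Submodule.mem_iInf]
  intro B' hB'
  by_cases hsub : B' ⊆ B
  · rw [Finset.eq_of_subset_of_card_le hsub (by rw [hcard B hB, hcard B' hB'])]
    exact Ideal.mul_mem_left _ _ hh
  · obtain ⟨i, hi, hiB⟩ := Finset.not_subset.1 hsub
    exact Ideal.mul_mem_right _ _ (Ideal.mem_of_dvd _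
      (Finset.dvd_prod_of_mem f (Finset.mem_compl.2 hiB)) (mem_familyIdeal hi))

/-- Symbolic powers of an intersection of ideals generated by equally many members of a generic
family. -/
theorem IsGenericFamily.symbolicPower_iInf [IsNoetherianRing A] {f : ι → A} {c : ℕ}
    (hf : IsGenericFamily f c) {ℬ : Set (Finset ι)} (hcard : ∀ B ∈ ℬ, B.card = c) (m : ℕ) :
    symbolicPower (⨅ B ∈ ℬ, familyIdeal f B) m = ⨅ B ∈ ℬ, familyIdeal f B ^ m := by
  set J := ⨅ B ∈ ℬ, familyIdeal f B with hJ
  have hJle : ∀ B ∈ ℬ, J ≤ familyIdeal f B := fun B hB => iInf₂_le B hB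
  have hcompl : ∀ B ∈ ℬ, IsRegularMod (familyIdeal f B) (∏ i ∈ Bᶜ, f i) := fun B hB =>
    .prod fun i hi => hf B i (Finset.mem_compl.1 hi) (hcard B hB).le
  ext g
  simp only [mem_symbolicPower_iff, Submodule.mem_iInf]
  constructor
  · intro hg B hB
    obtain ⟨t, ht, htJ⟩ := exists_isRegularMod_of_not_le (J := J) (I := (J ^ m).colon {g})
      fun P hP hle => by
        obtain ⟨t, htP, ht⟩ := hg P hP
        exact htP (hle (Submodule.mem_colon_singleton.2 ht))
    have htB : IsRegularMod (familyIdeal f (B ∪ ∅)) t := by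
      intro h hh
      rw [Finset.union_empty] at hh ⊢
      refine hcompl B hB h (hJle B hB (htJ _ ?_))
      rw [mul_left_comm]
      exact prod_compl_mul_mem_iInf hcard hB hh
    have := hf.isRegularMod_pow_sup B ∅ (Finset.disjoint_empty_right B)
      (by simp [hcard B hB]) m htB g
    rw [familyIdeal_empty, sup_bot_eq] at this
    exact this (Ideal.pow_right_mono (hJle B hB) m (Submodule.mem_colon_singleton.1 ht))
  · intro hg P hP
    obtain ⟨hPprime, x, hx⟩ := isAssociatedPrime_iff.1 hP
    obtain ⟨h, rfl⟩ := Ideal.Quotient.mk_surjective x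
    have hmem : ∀ t, t ∈ P ↔ t * h ∈ J := fun t => by
      rw [hx, Submodule.mem_colon_singleton, Submodule.mem_bot, Algebra.smul_def,
        Ideal.Quotient.algebraMap_eq, ← map_mul, Ideal.Quotient.eq_zero_iff_mem]
    have hhJ : h ∉ J := fun hh =>
      hPprime.ne_top ((Ideal.eq_top_iff_one P).2 ((hmem 1).2 (by simpa using hh)))
    obtain ⟨B, hB, hhB⟩ : ∃ B ∈ ℬ, h ∉ familyIdeal f B := by
      by_contra! hcon
      exact hhJ (by simpa [hJ, Submodule.mem_iInf] using hcon)
    refine ⟨(∏ i ∈ Bᶜ, f i) ^ m, fun hmP => hhB (hcompl B hB h (hJle B hB ?_)), ?_⟩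
    · exact (hmem _).1 (hPprime.mem_of_pow_mem m hmP)
    · have hle : Ideal.span {∏ i ∈ Bᶜ, f i} * familyIdeal f B ≤ J :=
        Ideal.span_singleton_mul_le_iff.2 fun z hz => prod_compl_mul_mem_iInf hcard hB hz
      have := Ideal.pow_right_mono hle m
      rw [mul_pow, Ideal.span_singleton_pow] at this
      exact this (Ideal.mul_mem_mul (Ideal.mem_span_singleton_self _) (hg B hB))

end SymbolicPower

section Height

variable {A ι : Type*} [CommRing A] {f : ι → A} {c : ℕ}

lemma IsRegularMod.notMem_of_mem_minimalPrimes {I P : Ideal A} {t : A} (ht : IsRegularMod I t)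
    (hP : P ∈ I.minimalPrimes) : t ∉ P := by
  intro htP
  have hreg : IsSMulRegular (A ⧸ I) t := by
    rw [isSMulRegular_iff_right_eq_zero_of_smul]
    intro x hx
    obtain ⟨h, rfl⟩ := Ideal.Quotient.mk_surjective x
    rw [Algebra.smul_def, Ideal.Quotient.algebraMap_eq, ← map_mul,
      Ideal.Quotient.eq_zero_iff_mem] at hx
    exact Ideal.Quotient.eq_zero_iff_mem.2 (ht h hx)
  exact hreg.notMem_of_mem_minimalPrimes (by rwa [Ideal.annihilator_quotient]) htP

lemma IsGenericFamily.card_le_height (hf : IsGenericFamily f c) {B : Finset ι}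
    (hB : B.card ≤ c + 1) (P : PrimeSpectrum A) (hP : familyIdeal f B ≤ P.asIdeal) :
    (B.card : ℕ∞) ≤ Order.height P := by
  classical
  induction B using Finset.induction_on generalizing P with
  | empty => simp
  | insert v B hv ih =>
    rw [Finset.card_insert_of_notMem hv] at hB ⊢
    obtain ⟨Q, hQ, hQP⟩ := Ideal.exists_minimalPrimes_le
      ((familyIdeal_mono (Finset.subset_insert v B)).trans hP)
    have hvQ := (hf B v hv (by omega)).notMem_of_mem_minimalPrimes hQ
    have hlt : (⟨Q, hQ.1.1⟩ : PrimeSpectrum A) < P := by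
      refine lt_of_le_of_ne hQP fun e => hvQ ?_
      have := hP (mem_familyIdeal (Finset.mem_insert_self v B))
      rwa [← e] at this
    push_cast
    exact (add_le_add_left (ih (by omega) _ hQ.1.2) 1).trans (Order.height_add_one_le hlt)

/-- The height of an intersection of powers of ideals generated by equally many members of a
generic family. -/
theorem IsGenericFamily.idealHeight_iInf_pow [Finite ι] [IsNoetherianRing A]
    (hf : IsGenericFamily f c) {ℬ : Set (Finset ι)} (hne : ℬ.Nonempty)
    (hcard : ∀ B ∈ ℬ, B.card = c) (htop : ∀ B ∈ ℬ, familyIdeal f B ≠ ⊤) {m : ℕ} (hm : 0 < m) :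
    idealHeight (⨅ B ∈ ℬ, familyIdeal f B ^ m) = c := by
  refine le_antisymm ?_ ?_
  · obtain ⟨B, hB⟩ := hne
    obtain ⟨P, hP⟩ := Ideal.nonempty_minimalPrimes (htop B hB)
    have hle : (⨅ B ∈ ℬ, familyIdeal f B ^ m) ≤ P :=
      (iInf₂_le B hB).trans ((Ideal.pow_le_self hm.ne').trans hP.1.2)
    refine (iInf₂_le (⟨P, hP.1.1⟩ : PrimeSpectrum A) hle).trans ?_
    rw [← PrimeSpectrum.height_eq_orderHeight]
    have hfin : (f '' (B : Set ι)).Finite := B.finite_toSet.image f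
    refine (Ideal.height_le_card_of_mem_minimalPrimes_span hfin hP).trans ?_
    rw [← hcard B hB, ← Set.ncard_coe_finset]
    exact_mod_cast Set.ncard_image_le B.finite_toSet
  · refine le_iInf₂ fun P hP => ?_
    have hfin : ℬ.Finite := Set.toFinite ℬ
    have hinf : hfin.toFinset.inf (fun B => familyIdeal f B ^ m) ≤ P.asIdeal := by
      simpa [Finset.inf_eq_iInf] using hP
    obtain ⟨B, hB, hle⟩ := (Ideal.IsPrime.inf_le' P.isPrime).1 hinf
    rw [Set.Finite.mem_toFinset] at hB
    rw [← hcard B hB]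
    exact hf.card_le_height (by simp [hcard B hB]) P (P.isPrime.le_of_pow_le hle)

end Height

section SubsetsRegular

variable {A : Type*} [CommRing A] {s c : ℕ} {f : Fin s → A}

lemma ofList_toList_map (W : Finset (Fin s)) :
    Ideal.ofList (W.toList.map f) = familyIdeal f W := by
  simp [Ideal.ofList, familyIdeal, Set.image]

lemma SubsetsRegular.isGenericFamily (h : SubsetsRegular f (c + 1)) : IsGenericFamily f c := by
  intro W v hv hW x hx
  have hreg := (h (W.toList ++ [v])
    (by simpa [List.nodup_append, W.nodup_toList] using fun a ha (e : a = v) => hv (e ▸ ha))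
    (by simpa using hW)).toIsWeaklyRegular
  rw [List.map_append, RingTheory.Sequence.isWeaklyRegular_append_iff, List.map_singleton,
    RingTheory.Sequence.isWeaklyRegular_singleton_iff, ofList_toList_map,
    isSMulRegular_iff_right_eq_zero_of_smul] at hreg
  have := hreg.2 (Submodule.Quotient.mk x) (by
    rw [← Submodule.Quotient.mk_smul, Submodule.Quotient.mk_eq_zero]
    simpa using hx)
  rw [Submodule.Quotient.mk_eq_zero] at this
  simpa using this

lemma SubsetsRegular.familyIdeal_ne_top (h : SubsetsRegular f c) {W : Finset (Fin s)}
    (hW : W.card ≤ c) : familyIdeal f W ≠ ⊤ := by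
  have := (h W.toList W.nodup_toList (by simpa using hW)).top_ne_smul
  rw [ofList_toList_map] at this
  simpa using this.symm

end SubsetsRegular

section Matroid

variable {s : ℕ} {Δ : Finset (Fin s) → Prop}

lemma exists_isBasisOf_superset {F : Finset (Fin s)} (hF : Δ F) : ∃ G, IsBasisOf Δ G ∧ F ⊆ G := by
  obtain ⟨G, hFG, hG⟩ := (Set.toFinite {G | Δ G}).exists_le_maximal hF
  exact ⟨G, ⟨hG.prop, fun H hH hGH => (hG.eq_of_le hH hGH).symm⟩, hFG⟩

lemma IsMatroid.hasBaseExchange_compl {r : ℕ} (hΔ : IsMatroid Δ)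
    (hr : ∀ F, IsBasisOf Δ F → F.card = r) :
    HasBaseExchange {B : Finset (Fin s) | IsBasisOf Δ Bᶜ} := by
  intro B hB B' hB' v hvB' hvB
  have hv : v ∈ Bᶜ := Finset.mem_compl.2 hvB
  have hcard : (Bᶜ.erase v).card < B'ᶜ.card := by
    rw [hr _ hB', ← hr _ hB]
    exact Finset.card_erase_lt_of_mem hv
  obtain ⟨u, huB', hu, hΔu⟩ := hΔ.2.2 _ _ hB'.1 (hΔ.2.1 _ _ hB.1 (Finset.erase_subset v _)) hcard
  rw [Finset.mem_compl] at huB'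
  have huv : u ≠ v := fun e => huB' (e ▸ hvB')
  have huB : u ∈ B := by simpa [huv] using hu
  refine ⟨u, huB, huB', ?_⟩
  have heq : (insert v (B.erase u))ᶜ = insert u (Bᶜ.erase v) := by
    ext x
    by_cases hx : x = u
    · simp [hx, huv]
    · simp [hx]
  rw [Set.mem_ofPred_eq, heq]
  obtain ⟨G, hG, hsub⟩ := exists_isBasisOf_superset hΔu
  rwa [Finset.eq_of_subset_of_card_le hsub]
  rw [hr G hG, Finset.card_insert_of_notMem hu, Finset.card_erase_add_one hv, hr _ hB]

end Matroid

section StanleyReisner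

variable {k : Type} [Field k] {A : Type*} [CommRing A] [Algebra k A] {s c : ℕ}
  {Δ : Finset (Fin s) → Prop} {f : Fin s → A}

lemma aeval_monomial_one (e : Fin s →₀ ℕ) :
    (aeval (R := k) f).toRingHom (monomial e 1) = e.prod fun i t => f i ^ t := by
  simp [aeval_monomial]

lemma map_familyIdeal_X (W : Finset (Fin s)) :
    Ideal.map (aeval (R := k) f).toRingHom (familyIdeal X W) = familyIdeal f W := by
  simp [familyIdeal, Ideal.map_span, Set.image_image]

variable (k)

/-- The intersection of powers of the ideals attached to the bases of a matroid is the extension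
of the corresponding intersection in the polynomial ring. -/
theorem IsGenericFamily.iInf_pow_eq (hf : IsGenericFamily f c) {ℬ : Set (Finset (Fin s))}
    (hne : ℬ.Nonempty) (hℬ : HasBaseExchange ℬ) (hcard : ∀ B ∈ ℬ, B.card = c) (m : ℕ) :
    (⨅ B ∈ ℬ, familyIdeal f B ^ m) = shiftedMonomialIdeal f ℬ 0 m ∧
    (⨅ B ∈ ℬ, familyIdeal f B ^ m) = Ideal.map (aeval (R := k) f).toRingHom
      (⨅ B ∈ ℬ, familyIdeal (X : Fin s → MvPolynomial (Fin s) k) B ^ m) := by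
  have h1 : (⨅ B ∈ ℬ, familyIdeal f B ^ m) ≤ shiftedMonomialIdeal f ℬ 0 m := by
    intro g hg
    simp only [Submodule.mem_iInf] at hg
    have := hf.mem_shiftedMonomialIdeal c ℬ hne hℬ hcard ∅ (by simp) (by simp) 0 m g
      (by simpa [familyIdeal_empty] using hg)
    simpa [familyIdeal_empty] using this
  have h2 : shiftedMonomialIdeal f ℬ 0 m ≤ Ideal.map (aeval (R := k) f).toRingHom
      (⨅ B ∈ ℬ, familyIdeal (X : Fin s → MvPolynomial (Fin s) k) B ^ m) := by
    refine Ideal.span_le.2 ?_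
    rintro _ ⟨e, he, rfl⟩
    change (e.prod fun i t => f i ^ t) ∈ _
    rw [← aeval_monomial_one (k := k)]
    refine Ideal.mem_map_of_mem _ ?_
    simp only [Submodule.mem_iInf]
    intro B hB
    rw [monomial_eq, C_1, one_mul]
    exact monomial_mem_familyIdeal_pow (by simpa using he B hB)
  have h3 : Ideal.map (aeval (R := k) f).toRingHom
      (⨅ B ∈ ℬ, familyIdeal (X : Fin s → MvPolynomial (Fin s) k) B ^ m) ≤
      ⨅ B ∈ ℬ, familyIdeal f B ^ m := by
    refine le_iInf₂ fun B hB => (Ideal.map_mono (iInf₂_le B hB)).trans ?_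
    rw [Ideal.map_pow, map_familyIdeal_X]
  exact ⟨le_antisymm h1 (h2.trans h3), le_antisymm (h1.trans h2) h3⟩

lemma map_stanleyReisnerIdeal (hf : IsGenericFamily f c) (hΔ : IsMatroid Δ) {r : ℕ}
    (hr : ∀ F, IsBasisOf Δ F → F.card = r)
    (hcard : ∀ B ∈ {B : Finset (Fin s) | IsBasisOf Δ Bᶜ}, B.card = c)
    (hne : {B : Finset (Fin s) | IsBasisOf Δ Bᶜ}.Nonempty) :
    Ideal.map (aeval (R := k) f).toRingHom (stanleyReisnerIdeal k Δ) =
      ⨅ B ∈ {B : Finset (Fin s) | IsBasisOf Δ Bᶜ}, familyIdeal f B := by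
  have hmain := (hf.iInf_pow_eq k hne (hΔ.hasBaseExchange_compl hr) hcard 1).1
  simp only [pow_one] at hmain
  rw [stanleyReisnerIdeal, Ideal.map_span]
  refine le_antisymm (Ideal.span_le.2 ?_) ?_
  · rintro _ ⟨_, ⟨F, hF, rfl⟩, rfl⟩
    simp only [SetLike.mem_coe, Submodule.mem_iInf]
    intro B hB
    obtain ⟨i, hi, hiB⟩ := Finset.not_subset.1 fun h : F ⊆ Bᶜ => hF (hΔ.2.1 _ _ hB.1 h)
    have : (aeval (R := k) f).toRingHom (∏ i ∈ F, X i) = ∏ i ∈ F, f i := by simp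
    rw [this]
    exact Ideal.mem_of_dvd _ (Finset.dvd_prod_of_mem f hi) (mem_familyIdeal (by simpa using hiB))
  · rw [hmain]
    refine Ideal.span_le.2 ?_
    rintro _ ⟨e, he, rfl⟩
    have hsupp : ¬ Δ e.support := by
      intro h
      obtain ⟨G, hG, hsub⟩ := exists_isBasisOf_superset h
      have h1 := he Gᶜ (by simpa using hG)
      have h0 : ∑ i ∈ Gᶜ, ((0 : Fin s → ℕ) i + e i) = 0 := by
        refine Finset.sum_eq_zero fun i hi => ?_
        have : i ∉ e.support := fun h => Finset.mem_compl.1 hi (hsub h)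
        simpa using this
      omega
    refine Ideal.mem_of_dvd _ ?_ (Ideal.subset_span ⟨_, ⟨e.support, hsupp, rfl⟩, rfl⟩)
    have : (aeval (R := k) f).toRingHom (∏ i ∈ e.support, X i) = ∏ i ∈ e.support, f i := by simp
    rw [this]
    exact Finset.prod_dvd_prod_of_dvd _ _ fun i hi =>
      dvd_pow_self _ (Finsupp.mem_support_iff.1 hi)

end StanleyReisner

lemma iInf_compl_eq {s : ℕ} {α : Type*} [CompleteLattice α] (p : Finset (Fin s) → Prop)
    (g : Finset (Fin s) → α) :
    (⨅ F ∈ {F | p F}, g Fᶜ) = ⨅ B ∈ {B : Finset (Fin s) | p Bᶜ}, g B :=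
  (compl_involutive (α := Finset (Fin s))).toPerm.iInf_congr fun F => by simp

theorem statement12 (k : Type) [Field k] [Infinite k] (s c n : ℕ) (hcs : c ≤ s) (hcn : c ≤ n)
    (Δ : Finset (Fin s) → Prop) (hmat : IsMatroid Δ)
    (hdim : ∀ F, IsBasisOf Δ F → F.card = s - c)
    (f : Fin s → MvPolynomial (Fin (n + 1)) k) (d : Fin s → ℕ)
    (hdeg : ∀ i, (f i).IsHomogeneous (d i))
    (hreg : SubsetsRegular f (c + 1))
    (m : ℕ) (hm : 0 < m) :
    symbolicPower (Ideal.map (MvPolynomial.aeval (R := k) f).toRingHom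
        (stanleyReisnerIdeal k Δ)) m
      = (⨅ F ∈ {F : Finset (Fin s) | IsBasisOf Δ F}, (Ideal.span (f '' ↑(Fᶜ))) ^ m) ∧
    symbolicPower (Ideal.map (MvPolynomial.aeval (R := k) f).toRingHom
        (stanleyReisnerIdeal k Δ)) m
      = Ideal.map (MvPolynomial.aeval (R := k) f).toRingHom
          (⨅ F ∈ {F : Finset (Fin s) | IsBasisOf Δ F},
            (Ideal.span ((X : Fin s → MvPolynomial (Fin s) k) '' ↑(Fᶜ))) ^ m) ∧
    (∃ T : Set (Fin s →₀ ℕ),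
      symbolicPower (Ideal.map (MvPolynomial.aeval (R := k) f).toRingHom
          (stanleyReisnerIdeal k Δ)) m
        = Ideal.span ((fun e : Fin s →₀ ℕ => e.prod fun i t => f i ^ t) '' T)) ∧
    idealHeight (symbolicPower (Ideal.map (MvPolynomial.aeval (R := k) f).toRingHom
        (stanleyReisnerIdeal k Δ)) m) = (c : ℕ∞) := by
  have hf := hreg.isGenericFamily
  set ℬ : Set (Finset (Fin s)) := {B | IsBasisOf Δ Bᶜ} with hℬ
  have hcard : ∀ B ∈ ℬ, B.card = c := by
    intro B hB
    have h1 := hdim _ hB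
    have h2 := Finset.card_le_univ B
    rw [Finset.card_compl] at h1
    rw [Fintype.card_fin] at h1 h2
    omega
  have hne : ℬ.Nonempty := by
    obtain ⟨G, hG, -⟩ := exists_isBasisOf_superset hmat.1
    exact ⟨Gᶜ, by simpa [hℬ] using hG⟩
  have hinf := iInf_compl_eq (IsBasisOf Δ) fun B => familyIdeal f B ^ m
  have hinfX := iInf_compl_eq (IsBasisOf Δ) fun B =>
    familyIdeal (X : Fin s → MvPolynomial (Fin s) k) B ^ m
  have hpow := hf.iInf_pow_eq k hne (hmat.hasBaseExchange_compl hdim) hcard m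
  simp only [familyIdeal] at hinf hinfX
  rw [map_stanleyReisnerIdeal k hf hmat hdim hcard hne, hf.symbolicPower_iInf hcard m]
  refine ⟨hinf.symm, ?_, ⟨_, hpow.1⟩, ?_⟩
  · rw [hinfX]
    exact hpow.2
  · exact hf.idealHeight_iInf_pow hne hcard
      (fun B hB => hreg.familyIdeal_ne_top (by simp [hcard B hB])) hm
end

section
/- Let Δ be a matroid on [s] of dimension s−1−c, let n ≥ c, and let f_1,…,f_s ∈ R = k[x_0,…,x_n] be homogeneous polynomials such that every subset of at most c+1 of them is an R-regular sequence. Then for every positive integer m, the ring R/(⋂_{F a basis of Δ} (f_i : i ∈ [s]\F)^m) is Cohen–Macaulay, and for every i ≥ 0, dim_k Tor_i^R(R/⋂_F (f_i : i∉F)^m, k) = dim_k Tor_i^S(S/I_Δ^{(m)}, k). -/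
/- ------------------------------------------------------------------
   Common definitions
------------------------------------------------------------------ -/

open MvPolynomial CategoryTheory

open MonoidalCategory TensorProduct

universe u

lemma CategoryTheory.ShortComplex.Exact.exists_mono_exact_of_iso {C : Type*} [Category* C]
    [Abelian C] {X : ShortComplex C} (hX : X.Exact) (hm : Mono X.f) {Y₁ Y₂ Y₃ : C}
    (e₁ : Y₁ ≅ X.X₁) (e₂ : X.X₂ ≅ Y₂) (e₃ : X.X₃ ≅ Y₃) {h : Y₂ ⟶ Y₃}
    (comm : X.g ≫ e₃.hom = e₂.hom ≫ h) :
    ∃ (d : Y₁ ⟶ Y₂) (w : d ≫ h = 0), Mono d ∧ (ShortComplex.mk d h w).Exact :=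
  ⟨e₁.hom ≫ X.f ≫ e₂.hom, by simp [← comm], inferInstance,
    ShortComplex.exact_of_iso (ShortComplex.isoMk e₁.symm e₂ e₃ (by simp) comm.symm) hX⟩

section TorSequence
variable {A : Type u} [CommRing A]

lemma ModuleCat.shortExact_whiskerRight {X : ShortComplex (ModuleCat.{u} A)} (hX : X.ShortExact)
    (P : ModuleCat.{u} A) [Module.Flat A P] :
    (X.map ((tensoringRight (ModuleCat.{u} A)).obj P)).ShortExact := by
  have := hX.mono_f
  have := hX.epi_g
  have hf : Function.Injective X.f.hom := (ModuleCat.mono_iff_injective _).1 hX.mono_f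
  have hg : Function.Surjective X.g.hom := (ModuleCat.epi_iff_surjective _).1 hX.epi_g
  have he : Function.Exact X.f.hom X.g.hom :=
    (ShortComplex.ShortExact.moduleCat_exact_iff_function_exact X).1 hX.exact
  refine ShortComplex.ShortExact.mk' ?_ ?_ ?_
  · exact (ShortComplex.ShortExact.moduleCat_exact_iff_function_exact _).2
      (rTensor_exact (P : Type u) he hg)
  · exact (ModuleCat.mono_iff_injective _).2
      (Module.Flat.rTensor_preserves_injective_linearMap _ hf)
  · exact (ModuleCat.epi_iff_surjective _).2 (LinearMap.rTensor_surjective _ hg)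

/-- The short complex of chain complexes obtained by tensoring a short complex of modules with a
chain complex. -/
noncomputable def CategoryTheory.ShortComplex.tensorComplex (X : ShortComplex (ModuleCat.{u} A))
    (P : ChainComplex (ModuleCat.{u} A) ℕ) : ShortComplex (ChainComplex (ModuleCat.{u} A) ℕ) where
  X₁ := (((tensoringLeft (ModuleCat.{u} A)).obj X.X₁).mapHomologicalComplex _).obj P
  X₂ := (((tensoringLeft (ModuleCat.{u} A)).obj X.X₂).mapHomologicalComplex _).obj P
  X₃ := (((tensoringLeft (ModuleCat.{u} A)).obj X.X₃).mapHomologicalComplex _).obj P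
  f := (NatTrans.mapHomologicalComplex ((tensoringLeft (ModuleCat.{u} A)).map X.f) _).app P
  g := (NatTrans.mapHomologicalComplex ((tensoringLeft (ModuleCat.{u} A)).map X.g) _).app P
  zero := by
    ext i : 1
    exact (X.map ((tensoringRight (ModuleCat.{u} A)).obj (P.X i))).zero

lemma CategoryTheory.ShortComplex.ShortExact.tensorComplex {X : ShortComplex (ModuleCat.{u} A)}
    (hX : X.ShortExact) {N : ModuleCat.{u} A} (P : ProjectiveResolution N) :
    (X.tensorComplex P.complex).ShortExact := by
  refine HomologicalComplex.shortExact_of_degreewise_shortExact _ fun i => ?_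
  have : Module.Projective A (P.complex.X i) :=
    (IsProjective.iff_projective (P.complex.X i)).2 (P.projective i)
  exact ModuleCat.shortExact_whiskerRight hX (P.complex.X i)

/-- `Tor_i` as the homology of the tensor product with a projective resolution. -/
noncomputable def torIso (M N : ModuleCat.{u} A) (P : ProjectiveResolution N) (i : ℕ) :
    ((Tor (ModuleCat.{u} A) i).obj M).obj N ≅
      ((((tensoringLeft (ModuleCat.{u} A)).obj M).mapHomologicalComplex _).obj
        P.complex).homology i :=
  P.isoLeftDerivedObj _ i

/-- The zeroth homology of the tensor product of a module with a projective resolution. -/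
noncomputable def tensorHomologyZeroIso (M N : ModuleCat.{u} A) (P : ProjectiveResolution N) :
    ((((tensoringLeft (ModuleCat.{u} A)).obj M).mapHomologicalComplex _).obj P.complex).homology 0 ≅
      M ⊗ N :=
  ChainComplex.isoHomologyι₀ _ ≪≫
    (haveI : Limits.PreservesFiniteColimits ((tensoringLeft (ModuleCat.{u} A)).obj M) :=
      inferInstanceAs (Limits.PreservesFiniteColimits (tensorLeft M))
    asIso (P.fromLeftDerivedZero' ((tensoringLeft (ModuleCat.{u} A)).obj M)))

lemma tensorHomologyZeroIso_naturality {M M' N : ModuleCat.{u} A} (f : M ⟶ M')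
    (P : ProjectiveResolution N) :
    HomologicalComplex.homologyMap
      ((NatTrans.mapHomologicalComplex ((tensoringLeft (ModuleCat.{u} A)).map f) _).app
        P.complex) 0 ≫
        (tensorHomologyZeroIso M' N P).hom = (tensorHomologyZeroIso M N P).hom ≫ f ▷ N := by
  dsimp only [tensorHomologyZeroIso, Iso.trans_hom, asIso_hom]
  rw [← Category.assoc, Category.assoc (ChainComplex.isoHomologyι₀ _).hom]
  have : HomologicalComplex.opcyclesMap ((NatTrans.mapHomologicalComplex
      ((tensoringLeft (ModuleCat.{u} A)).map f) _).app P.complex) 0 ≫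
        P.fromLeftDerivedZero' ((tensoringLeft (ModuleCat.{u} A)).obj M') =
      P.fromLeftDerivedZero' ((tensoringLeft (ModuleCat.{u} A)).obj M) ≫ f ▷ N := by
    rw [← cancel_epi (HomologicalComplex.pOpcycles _ _),
      HomologicalComplex.p_opcyclesMap_assoc]
    rw [ProjectiveResolution.pOpcycles_comp_fromLeftDerivedZero']
    rw [ProjectiveResolution.pOpcycles_comp_fromLeftDerivedZero'_assoc]
    exact ((tensoringLeft (ModuleCat.{u} A)).map f).naturality (P.π.f 0) |>.symm
  rw [← this, ← Category.assoc]
  congr 1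
  exact HomologicalComplex.homologyι_naturality _ _

/-- All higher Tor modules of `M` and `N` vanish. -/
def TorAcyclic (M N : ModuleCat.{u} A) : Prop :=
  ∀ i : ℕ, Limits.IsZero (((Tor (ModuleCat.{u} A) (i + 1)).obj M).obj N)

lemma torAcyclic_iff {M N : ModuleCat.{u} A} (P : ProjectiveResolution N) :
    TorAcyclic M N ↔ ∀ i : ℕ, Limits.IsZero
      ((((tensoringLeft (ModuleCat.{u} A)).obj M).mapHomologicalComplex _).obj
        P.complex |>.homology (i + 1)) :=
  forall_congr' fun i => (torIso M N P (i + 1)).isZero_iff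

lemma torAcyclic_of_flat (M N : ModuleCat.{u} A) [Module.Flat A M] : TorAcyclic M N := by
  let P := projectiveResolution N
  rw [torAcyclic_iff P]
  intro i
  rw [← HomologicalComplex.exactAt_iff_isZero_homology,
    HomologicalComplex.exactAt_iff' _ (i + 2) (i + 1) i (by simp) (by simp)]
  refine (ShortComplex.ShortExact.moduleCat_exact_iff_function_exact _).2 ?_
  have h := P.complex_exactAt_succ i
  rw [HomologicalComplex.exactAt_iff' _ (i + 2) (i + 1) i (by simp) (by simp)] at h
  exact Module.Flat.lTensor_exact (M : Type u)
    ((ShortComplex.ShortExact.moduleCat_exact_iff_function_exact _).1 h)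

variable {X : ShortComplex (ModuleCat.{u} A)} {N : ModuleCat.{u} A}

lemma TorAcyclic.middle (hX : X.ShortExact) (h₁ : TorAcyclic X.X₁ N) (h₃ : TorAcyclic X.X₃ N) :
    TorAcyclic X.X₂ N := by
  let P := projectiveResolution N
  rw [torAcyclic_iff P] at *
  intro i
  exact ((hX.tensorComplex P).homology_exact₂ (i + 1)).isZero_of_both_zeros
    ((h₁ i).eq_zero_of_src _) ((h₃ i).eq_zero_of_tgt _)

lemma TorAcyclic.left (hX : X.ShortExact) (h₂ : TorAcyclic X.X₂ N) (h₃ : TorAcyclic X.X₃ N) :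
    TorAcyclic X.X₁ N := by
  let P := projectiveResolution N
  rw [torAcyclic_iff P] at *
  intro i
  exact ((hX.tensorComplex P).homology_exact₁ (i + 2) (i + 1) (by simp)).isZero_of_both_zeros
    ((h₃ (i + 1)).eq_zero_of_src _) ((h₂ i).eq_zero_of_tgt _)

lemma TorAcyclic.mono_whiskerRight (hX : X.ShortExact) (h₃ : TorAcyclic X.X₃ N) :
    Mono (X.f ▷ N) := by
  let P := projectiveResolution N
  rw [torAcyclic_iff P] at h₃
  have h := ((hX.tensorComplex P).homology_exact₁ 1 0 (by simp)).mono_g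
    ((h₃ 0).eq_zero_of_src _)
  have e := tensorHomologyZeroIso_naturality X.f P
  rw [← Iso.inv_comp_eq] at e
  rw [← e]
  have : Mono (HomologicalComplex.homologyMap ((NatTrans.mapHomologicalComplex
    ((tensoringLeft (ModuleCat.{u} A)).map X.f) _).app P.complex) 0) := h
  infer_instance

lemma exists_tor_one_exact (hX : X.ShortExact) (h₂ : TorAcyclic X.X₂ N) :
    ∃ (d : ((Tor (ModuleCat.{u} A) 1).obj X.X₃).obj N ⟶ X.X₁ ⊗ N) (w : d ≫ X.f ▷ N = 0),
      Mono d ∧ (ShortComplex.mk d (X.f ▷ N) w).Exact := by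
  let P := projectiveResolution N
  rw [torAcyclic_iff P] at h₂
  exact ShortComplex.Exact.exists_mono_exact_of_iso
    ((hX.tensorComplex P).homology_exact₁ 1 0 (by simp))
    ((hX.tensorComplex P).mono_δ 1 0 (by simp) (h₂ 0)) (torIso X.X₃ N P 1)
    (tensorHomologyZeroIso X.X₁ N P) (tensorHomologyZeroIso X.X₂ N P)
    (tensorHomologyZeroIso_naturality X.f P)

lemma TorAcyclic.right (hX : X.ShortExact) (h₁ : TorAcyclic X.X₁ N)
    (h₂ : TorAcyclic X.X₂ N) (hm : Mono (X.f ▷ N)) :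
    TorAcyclic X.X₃ N := by
  rintro (_ | i)
  · obtain ⟨d, w, hd, he⟩ := exists_tor_one_exact hX h₂
    have : d = 0 := by rwa [← cancel_mono (X.f ▷ N), Limits.zero_comp]
    exact Limits.IsZero.of_mono_eq_zero d this
  · let P := projectiveResolution N
    rw [torAcyclic_iff P] at h₁ h₂
    rw [(torIso X.X₃ N P _).isZero_iff]
    exact ((hX.tensorComplex P).homology_exact₃ (i + 2) (i + 1) (by simp)).isZero_of_both_zeros
      ((h₂ (i + 1)).eq_zero_of_src _) ((h₁ i).eq_zero_of_tgt _)

lemma nonempty_tor_shift_iso (hX : X.ShortExact) (h₂ : TorAcyclic X.X₂ N) (i : ℕ) :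
    Nonempty (((Tor (ModuleCat.{u} A) (i + 2)).obj X.X₃).obj N ≅
      ((Tor (ModuleCat.{u} A) (i + 1)).obj X.X₁).obj N) := by
  let P := projectiveResolution N
  rw [torAcyclic_iff P] at h₂
  exact ⟨torIso X.X₃ N P _ ≪≫ (hX.tensorComplex P).δIso (i + 2) (i + 1) (by simp)
    (h₂ (i + 1)) (h₂ i) ≪≫ (torIso X.X₁ N P _).symm⟩

end TorSequence

section BaseChange

lemma ModuleCat.shortExact_of_exact {A : Type*} [CommRing A] {M₁ M₂ M₃ : Type u} [AddCommGroup M₁]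
    [AddCommGroup M₂] [AddCommGroup M₃] [Module A M₁] [Module A M₂] [Module A M₃]
    {f : M₁ →ₗ[A] M₂} {g : M₂ →ₗ[A] M₃} (hf : Function.Injective f) (hfg : Function.Exact f g)
    (hg : Function.Surjective g) :
    (ModuleCat.shortComplexOfCompEqZero f g hfg.linearMap_comp_eq_zero).ShortExact :=
  ModuleCat.shortComplex_shortExact _ hfg hf hg

lemma rank_restrictScalars_eq_of_addEquiv {k A B X Y : Type} [Field k] [CommRing A] [CommRing B]
    [Algebra k A] [Algebra k B] [AddCommGroup X] [Module A X] [AddCommGroup Y] [Module B Y]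
    (e : X ≃+ Y) (he : ∀ (c : k) (x : X), e (algebraMap k A c • x) = algebraMap k B c • e x) :
    Module.rank k (RestrictScalars k A X) = Module.rank k (RestrictScalars k B Y) :=
  LinearEquiv.rank_eq
    { (RestrictScalars.addEquiv k A X).trans (e.trans (RestrictScalars.addEquiv k B Y).symm) with
      map_smul' := fun c x => he c x }

section

variable {k A : Type} [Field k] [CommRing A] [Algebra k A] {K F M N : Type} [AddCommGroup K]
  [AddCommGroup F] [AddCommGroup M] [AddCommGroup N] [Module A K] [Module A F] [Module A M]
  [Module A N] {f : K →ₗ[A] F} {g : F →ₗ[A] M}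

lemma torRank_eq_rank_of_iso {X : ModuleCat A} {Y : Type} [AddCommGroup Y] [Module A Y]
    (e : X ≅ ModuleCat.of A Y) :
    Module.rank k (RestrictScalars k A X) = Module.rank k (RestrictScalars k A Y) :=
  rank_restrictScalars_eq_of_addEquiv e.toLinearEquiv.toAddEquiv
    fun c x => e.toLinearEquiv.map_smul (algebraMap k A c) x

variable (k A M N) in
lemma torRank_zero : torRank k A M N 0 = Module.rank k (RestrictScalars k A (M ⊗[A] N)) :=
  torRank_eq_rank_of_iso (Y := M ⊗[A] N) (torIso _ _ (projectiveResolution _) 0 ≪≫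
    tensorHomologyZeroIso (ModuleCat.of A M) (ModuleCat.of A N) _)

lemma torRank_one [Module.Flat A F] (hf : Function.Injective f) (hfg : Function.Exact f g)
    (hg : Function.Surjective g) :
    torRank k A M N 1 =
      Module.rank k (RestrictScalars k A (LinearMap.ker (f.rTensor N))) := by
  obtain ⟨d, w, hd, he⟩ := exists_tor_one_exact (ModuleCat.shortExact_of_exact hf hfg hg)
    (torAcyclic_of_flat (ModuleCat.of A F) (ModuleCat.of A N))
  have hd' : Function.Injective d.hom := (ModuleCat.mono_iff_injective _).1 hd
  have he' : Function.Exact d.hom (f.rTensor N) :=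
    (ShortComplex.ShortExact.moduleCat_exact_iff_function_exact _).1 he
  exact torRank_eq_rank_of_iso (((LinearEquiv.ofInjective _ hd').trans
    (LinearEquiv.ofEq _ _ he'.linearMap_ker_eq.symm)).toModuleIso)

lemma torRank_add_two [Module.Flat A F] (hf : Function.Injective f) (hfg : Function.Exact f g)
    (hg : Function.Surjective g) (i : ℕ) : torRank k A M N (i + 2) = torRank k A K N (i + 1) := by
  obtain ⟨e⟩ := nonempty_tor_shift_iso (ModuleCat.shortExact_of_exact hf hfg hg)
    (torAcyclic_of_flat (ModuleCat.of A F) (ModuleCat.of A N)) i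
  exact torRank_eq_rank_of_iso e

lemma TorAcyclic.rTensor_injective (hf : Function.Injective f) (hfg : Function.Exact f g)
    (hg : Function.Surjective g) (h : TorAcyclic (ModuleCat.of A M) (ModuleCat.of A N)) :
    Function.Injective (f.rTensor N) :=
  (ModuleCat.mono_iff_injective _).1
    (h.mono_whiskerRight (ModuleCat.shortExact_of_exact hf hfg hg))

end

lemma rank_ker_eq_of_addEquiv {k A B X Y X' Y' : Type} [Field k] [CommRing A] [CommRing B]
    [Algebra k A] [Algebra k B] [AddCommGroup X] [Module A X] [AddCommGroup Y] [Module B Y]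
    [AddCommGroup X'] [Module A X'] [AddCommGroup Y'] [Module B Y'] (a : X →ₗ[A] X')
    (b : Y →ₗ[B] Y') (e : X ≃+ Y)
    (he : ∀ (c : k) (x : X), e (algebraMap k A c • x) = algebraMap k B c • e x)
    (hab : ∀ x, a x = 0 ↔ b (e x) = 0) :
    Module.rank k (RestrictScalars k A (LinearMap.ker a)) =
      Module.rank k (RestrictScalars k B (LinearMap.ker b)) :=
  rank_restrictScalars_eq_of_addEquiv
    { toFun := fun x => ⟨e x, (hab x).1 x.2⟩
      invFun := fun y => ⟨e.symm y, (hab _).2 (by simp)⟩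
      left_inv := fun x => by simp
      right_inv := fun y => by simp
      map_add' := fun x y => Subtype.ext (map_add e _ _) } fun c x => Subtype.ext (he c x)

lemma exists_flat_presentation {A : Type} [CommRing A] (M : Type) [AddCommGroup M] [Module A M] :
    ∃ (K F : ModuleCat.{0} A) (f : K →ₗ[A] F) (g : F →ₗ[A] M), Module.Flat A F ∧
      Function.Injective f ∧ Function.Exact f g ∧ Function.Surjective g := by
  let g : ModuleCat.of A (M →₀ A) →ₗ[A] M := Finsupp.linearCombination A id
  exact ⟨ModuleCat.of A (LinearMap.ker g), ModuleCat.of A (M →₀ A), (LinearMap.ker g).subtype, g,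
    inferInstanceAs (Module.Flat A (M →₀ A)), (LinearMap.ker g).injective_subtype,
    LinearMap.exact_subtype_ker_map g, Finsupp.linearCombination_id_surjective A M⟩

variable {k S R N : Type} [Field k] [CommRing S] [CommRing R] [Algebra k S] [Algebra k R]
  [Algebra S R] [IsScalarTower k S R] [AddCommGroup N] [Module S N] [Module R N]
  [IsScalarTower S R N]

/-- The tensor product over `R` of an `R`-module with an extended module is the tensor product
over `S`. -/
noncomputable def baseChangeTensorEquiv (M : Type) [AddCommGroup M] [Module S M] :
    (R ⊗[S] M) ⊗[R] N ≃ₗ[S] M ⊗[S] N :=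
  ((TensorProduct.comm R (R ⊗[S] M) N ≪≫ₗ
    AlgebraTensorModule.cancelBaseChange S R R N M).restrictScalars S) ≪≫ₗ
      TensorProduct.comm S N M

lemma baseChangeTensorEquiv_rTensor {M M' : Type} [AddCommGroup M] [Module S M] [AddCommGroup M']
    [Module S M'] (g : M →ₗ[S] M') (x : (R ⊗[S] M) ⊗[R] N) :
    baseChangeTensorEquiv M' ((g.baseChange R).rTensor N x) =
      g.rTensor N (baseChangeTensorEquiv M x) := by
  induction x with
  | zero => simp
  | add x y hx hy => simp only [map_add, hx, hy]
  | tmul x y =>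
    induction x with
    | zero => simp
    | add x y hx hy => simp only [map_add, add_tmul, hx, hy]
    | tmul r m => simp [baseChangeTensorEquiv]

lemma baseChangeTensorEquiv_algebraMap_smul {M : Type} [AddCommGroup M] [Module S M] (c : k)
    (x : (R ⊗[S] M) ⊗[R] N) :
    baseChangeTensorEquiv M (algebraMap k R c • x) =
      algebraMap k S c • baseChangeTensorEquiv M x := by
  rw [IsScalarTower.algebraMap_apply k S R, algebraMap_smul, map_smul]

lemma TorAcyclic.baseChange_injective {K F M : Type} [AddCommGroup K] [AddCommGroup F]
    [AddCommGroup M] [Module S K] [Module S F] [Module S M] {f : K →ₗ[S] F} {g : F →ₗ[S] M}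
    (hf : Function.Injective f) (hfg : Function.Exact f g) (hg : Function.Surjective g)
    (h : TorAcyclic (ModuleCat.of S M) (ModuleCat.of S R)) :
    Function.Injective (f.baseChange R) :=
  (LinearMap.lTensor_inj_iff_rTensor_inj R f).2 (h.rTensor_injective hf hfg hg)

section

variable {K F M : Type} [AddCommGroup K] [AddCommGroup F] [AddCommGroup M] [Module S K]
  [Module S F] [Module S M] [Module.Flat S F] {f : K →ₗ[S] F} {g : F →ₗ[S] M}

lemma torRank_one_baseChange (hf : Function.Injective f) (hfg : Function.Exact f g)
    (hg : Function.Surjective g) (h : TorAcyclic (ModuleCat.of S M) (ModuleCat.of S R)) :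
    torRank k R (R ⊗[S] M) N 1 = torRank k S M N 1 := by
  rw [torRank_one hf hfg hg, torRank_one (f := f.baseChange R) (g := g.baseChange R)
    (h.baseChange_injective hf hfg hg) (lTensor_exact R hfg hg) (LinearMap.lTensor_surjective R hg)]
  refine rank_ker_eq_of_addEquiv (X := (R ⊗[S] K) ⊗[R] N) (Y := K ⊗[S] N)
    (X' := (R ⊗[S] F) ⊗[R] N) (Y' := F ⊗[S] N) ((f.baseChange R).rTensor N) (f.rTensor N)
    (baseChangeTensorEquiv (S := S) (R := R) (N := N) K).toAddEquiv
    (baseChangeTensorEquiv_algebraMap_smul (k := k)) fun x => ?_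
  rw [← (baseChangeTensorEquiv (S := S) (R := R) (N := N) F).map_eq_zero_iff,
    baseChangeTensorEquiv_rTensor]
  rfl

end

theorem torRank_baseChange (i : ℕ) (M : Type) [AddCommGroup M] [Module S M]
    (h : TorAcyclic (ModuleCat.of S M) (ModuleCat.of S R)) :
    torRank k R (R ⊗[S] M) N i = torRank k S M N i := by
  induction i using Nat.twoStepInduction generalizing M with
  | zero =>
    rw [torRank_zero, torRank_zero]
    refine rank_restrictScalars_eq_of_addEquiv (X := (R ⊗[S] M) ⊗[R] N) (Y := M ⊗[S] N)
      (baseChangeTensorEquiv (S := S) (R := R) (N := N) M).toAddEquiv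
      baseChangeTensorEquiv_algebraMap_smul
  | one =>
    obtain ⟨K, F, f, g, _, hf, hfg, hg⟩ := exists_flat_presentation (A := S) M
    exact torRank_one_baseChange hf hfg hg h
  | more i _ ih =>
    obtain ⟨K, F, f, g, _, hf, hfg, hg⟩ := exists_flat_presentation (A := S) M
    rw [torRank_add_two hf hfg hg, torRank_add_two (f := f.baseChange R) (g := g.baseChange R)
      (h.baseChange_injective hf hfg hg) (lTensor_exact R hfg hg)
      (LinearMap.lTensor_surjective R hg)]
    exact ih _ (TorAcyclic.left (ModuleCat.shortExact_of_exact hf hfg hg)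
      (torAcyclic_of_flat (ModuleCat.of S F) (ModuleCat.of S R)) h)

end BaseChange

section MinimalWeight

variable {s : ℕ}

/-- The weight of `i` for the exponent vector `a`; the second summand breaks ties. -/
def expWeight (a : Fin s →₀ ℕ) (i : Fin s) : ℕ := 2 ^ s * a i + 2 ^ (i : ℕ)

lemma expWeight_le_iff (a : Fin s →₀ ℕ) {t i : Fin s} (h : t ≠ i) :
    expWeight a t ≤ expWeight a i ↔ a t + (if i < t then 1 else 0) ≤ a i := by
  have ht : 2 ^ (t : ℕ) < 2 ^ s := Nat.pow_lt_pow_right (by norm_num) t.2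
  have hi : 2 ^ (i : ℕ) < 2 ^ s := Nat.pow_lt_pow_right (by norm_num) i.2
  have ht₀ : 0 < 2 ^ (t : ℕ) := by positivity
  have hi₀ : 0 < 2 ^ (i : ℕ) := by positivity
  have hlt : (2 ^ (t : ℕ) ≤ 2 ^ (i : ℕ)) ↔ (t : ℕ) ≤ i := Nat.pow_le_pow_iff_right (by norm_num)
  have hti : (t : ℕ) ≠ i := fun h' => h (Fin.ext h')
  unfold expWeight
  rcases lt_trichotomy (a t) (a i) with h' | h' | h'
  · have : 2 ^ s * (a t + 1) ≤ 2 ^ s * a i := Nat.mul_le_mul_left _ h'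
    constructor
    · intro; split_ifs <;> omega
    · intro
      rw [Nat.mul_succ] at this
      omega
  · rw [h', Nat.add_le_add_iff_left, hlt]
    split_ifs with h'' <;> rw [Fin.lt_def] at h'' <;> omega
  · have : 2 ^ s * (a i + 1) ≤ 2 ^ s * a t := Nat.mul_le_mul_left _ h'
    constructor
    · intro
      rw [Nat.mul_succ] at this
      omega
    · intro; omega

/-- The total weight of a set. -/
def setWeight (a : Fin s →₀ ℕ) (T : Finset (Fin s)) : ℕ := ∑ i ∈ T, expWeight a i

lemma setWeight_eq (a : Fin s →₀ ℕ) (T : Finset (Fin s)) :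
    setWeight a T = 2 ^ s * ∑ i ∈ T, a i + ∑ i ∈ T.map Fin.valEmbedding, 2 ^ i := by
  simp [setWeight, expWeight, Finset.sum_add_distrib, Finset.mul_sum]

lemma sum_two_pow_map_lt (T : Finset (Fin s)) : ∑ i ∈ T.map Fin.valEmbedding, 2 ^ i < 2 ^ s :=
  Nat.geomSum_lt le_rfl fun i hi => by
    obtain ⟨j, -, rfl⟩ := Finset.mem_map.1 hi
    exact j.2

lemma setWeight_injective (a : Fin s →₀ ℕ) : Function.Injective (setWeight a) := by
  intro T T' h
  have h' := congrArg (· % 2 ^ s) h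
  simp only [setWeight_eq, Nat.mul_add_mod, Nat.mod_eq_of_lt (sum_two_pow_map_lt _)] at h'
  exact Finset.map_injective _ (Finset.geomSum_injective le_rfl h')

lemma setWeight_mono {a b : Fin s →₀ ℕ} (h : a ≤ b) (T : Finset (Fin s)) :
    setWeight a T ≤ setWeight b T :=
  Finset.sum_le_sum fun i _ => by
    unfold expWeight
    have := h i
    gcongr

lemma setWeight_congr {a b : Fin s →₀ ℕ} {T : Finset (Fin s)} (h : ∀ i ∈ T, a i = b i) :
    setWeight a T = setWeight b T :=
  Finset.sum_congr rfl fun i hi => by rw [expWeight, h i hi, expWeight]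

lemma setWeight_lt_iff (a : Fin s →₀ ℕ) (T : Finset (Fin s)) (m : ℕ) :
    setWeight a T < 2 ^ s * m ↔ ∑ i ∈ T, a i < m := by
  have := sum_two_pow_map_lt T
  rw [setWeight_eq]
  constructor
  · intro h
    by_contra! h'
    have := Nat.mul_le_mul_left (2 ^ s) h'
    omega
  · intro h
    have := Nat.mul_le_mul_left (2 ^ s) (Nat.succ_le_of_lt h)
    rw [Nat.mul_succ] at this
    omega

variable (B : Finset (Finset (Fin s)))

/-- The symmetric exchange property of a family of sets. -/
def SymmExchange : Prop :=
  ∀ T ∈ B, ∀ T' ∈ B, ∀ t ∈ T, t ∉ T' → ∃ i ∈ T', i ∉ T ∧ insert i (T.erase t) ∈ B ∧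
    insert t (T'.erase i) ∈ B

open Classical in
/-- The member of `B` of minimal weight. -/
noncomputable def minSet (a : Fin s →₀ ℕ) : Finset (Fin s) :=
  if h : B.Nonempty then (B.exists_min_image (setWeight a) h).choose else ∅

variable {B}

lemma minSet_mem (hB : B.Nonempty) (a : Fin s →₀ ℕ) : minSet B a ∈ B := by
  rw [minSet, dif_pos hB]
  exact (B.exists_min_image (setWeight a) hB).choose_spec.1

lemma setWeight_minSet_le (a : Fin s →₀ ℕ) {T : Finset (Fin s)} (hT : T ∈ B) :
    setWeight a (minSet B a) ≤ setWeight a T := by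
  have hB : B.Nonempty := ⟨T, hT⟩
  rw [minSet, dif_pos hB]
  exact (B.exists_min_image (setWeight a) hB).choose_spec.2 T hT

lemma minSet_eq_of_forall_le {a : Fin s →₀ ℕ} {T : Finset (Fin s)} (hT : T ∈ B)
    (h : ∀ T' ∈ B, setWeight a T ≤ setWeight a T') : minSet B a = T :=
  setWeight_injective a ((setWeight_minSet_le a hT).antisymm (h _ (minSet_mem ⟨T, hT⟩ a)))

lemma setWeight_insert_erase (a : Fin s →₀ ℕ) {T : Finset (Fin s)} {t i : Fin s} (ht : t ∈ T)
    (hi : i ∉ T) :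
    setWeight a (insert i (T.erase t)) + expWeight a t = setWeight a T + expWeight a i := by
  have h1 : setWeight a (insert i (T.erase t)) = expWeight a i + setWeight a (T.erase t) :=
    Finset.sum_insert fun h => hi (Finset.mem_of_mem_erase h)
  have h2 : expWeight a t + setWeight a (T.erase t) = setWeight a T :=
    Finset.add_sum_erase T _ ht
  omega

/-- Local optimality implies global optimality. -/
lemma setWeight_le_of_exchange (hB : SymmExchange B) {a : Fin s →₀ ℕ} {T : Finset (Fin s)}
    (hT : T ∈ B) (h : ∀ t ∈ T, ∀ i ∉ T, insert i (T.erase t) ∈ B → expWeight a t ≤ expWeight a i)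
    (hcard : ∀ T' ∈ B, T'.card = T.card) :
    ∀ T' ∈ B, setWeight a T ≤ setWeight a T' := by
  suffices ∀ (d : ℕ), ∀ T' ∈ B, (T \ T').card = d → setWeight a T ≤ setWeight a T' from
    fun T' hT' => this _ T' hT' rfl
  intro d
  induction d with
  | zero =>
    intro T' hT' h0
    rw [Finset.card_eq_zero, Finset.sdiff_eq_empty_iff_subset] at h0
    rw [Finset.eq_of_subset_of_card_le h0 (hcard T' hT').le]
  | succ d ih =>
    intro T' hT' hd
    obtain ⟨t, ht⟩ := Finset.card_pos.1 (by omega : 0 < (T \ T').card)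
    obtain ⟨htT, htT'⟩ := Finset.mem_sdiff.1 ht
    obtain ⟨i, hiT', hiT, h1, h2⟩ := hB T hT T' hT' t htT htT'
    have h3 := h t htT i hiT h1
    have h4 : T \ insert t (T'.erase i) = (T \ T').erase t := by
      ext j
      simp only [Finset.mem_sdiff, Finset.mem_insert, Finset.mem_erase]
      have : j ∈ T → j ≠ i := fun hj e => hiT (e ▸ hj)
      tauto
    have h5 := ih _ h2 (by rw [h4, Finset.card_erase_of_mem ht, hd]; rfl)
    have h6 := setWeight_insert_erase a hiT' htT'
    omega

variable (B) in
open Classical in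
/-- The smallest vector agreeing with `a` on `T` for which `T` has minimal weight. -/
noncomputable def roundOn (T : Finset (Fin s)) (a : Fin s →₀ ℕ) : Fin s →₀ ℕ :=
  Finsupp.equivFunOnFinite.symm fun i => if i ∈ T then a i else
    (T.filter fun t => insert i (T.erase t) ∈ B).sup fun t => a t + if i < t then 1 else 0

lemma roundOn_apply_of_mem {T : Finset (Fin s)} (a : Fin s →₀ ℕ) {i : Fin s} (hi : i ∈ T) :
    roundOn B T a i = a i := by
  simp [roundOn, hi]

lemma roundOn_congr {a b : Fin s →₀ ℕ} {T : Finset (Fin s)} (h : ∀ i ∈ T, a i = b i) :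
    roundOn B T a = roundOn B T b := by
  ext i
  simp only [roundOn, Finsupp.equivFunOnFinite_symm_apply_apply]
  split_ifs with hi
  · exact h i hi
  · exact Finset.sup_congr rfl fun t ht => by rw [h t (Finset.mem_filter.1 ht).1]

lemma roundOn_roundOn (T : Finset (Fin s)) (a : Fin s →₀ ℕ) :
    roundOn B T (roundOn B T a) = roundOn B T a :=
  roundOn_congr fun _ hi => roundOn_apply_of_mem a hi

lemma roundOn_le_iff {T : Finset (Fin s)} {a : Fin s →₀ ℕ} :
    roundOn B T a ≤ a ↔
      ∀ t ∈ T, ∀ i ∉ T, insert i (T.erase t) ∈ B → expWeight a t ≤ expWeight a i := by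
  constructor
  · intro h t ht i hi hti
    rw [expWeight_le_iff a (ne_of_mem_of_not_mem ht hi)]
    have := h i
    simp only [roundOn, Finsupp.equivFunOnFinite_symm_apply_apply, if_neg hi,
      Finset.sup_le_iff] at this
    exact this t (Finset.mem_filter.2 ⟨ht, hti⟩)
  · intro h i
    by_cases hi : i ∈ T
    · rw [roundOn_apply_of_mem a hi]
    · simp only [roundOn, Finsupp.equivFunOnFinite_symm_apply_apply, if_neg hi,
        Finset.sup_le_iff]
      intro t ht
      obtain ⟨ht, hti⟩ := Finset.mem_filter.1 ht
      exact (expWeight_le_iff a (ne_of_mem_of_not_mem ht hi)).1 (h t ht i hi hti)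

lemma minSet_eq_iff (hB : SymmExchange B) {c : ℕ} (hcard : ∀ T ∈ B, T.card = c)
    {a : Fin s →₀ ℕ} {T : Finset (Fin s)} (hT : T ∈ B) :
    minSet B a = T ↔ roundOn B T a ≤ a := by
  rw [roundOn_le_iff]
  constructor
  · rintro rfl t ht i hi h
    have h1 := setWeight_minSet_le a h
    have h2 := setWeight_insert_erase a ht hi
    omega
  · intro h
    exact minSet_eq_of_forall_le hT (setWeight_le_of_exchange hB hT h
      fun T' hT' => (hcard T' hT').trans (hcard T hT).symm)

variable (B) in
/-- The smallest vector with the same set of minimal weight as `a` which agrees with `a` there. -/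
noncomputable def roundExp (a : Fin s →₀ ℕ) : Fin s →₀ ℕ := roundOn B (minSet B a) a

variable (B) in
/-- The minimal weight of a member of `B`. -/
noncomputable def minWeight (a : Fin s →₀ ℕ) : ℕ := setWeight a (minSet B a)

lemma minWeight_le (a : Fin s →₀ ℕ) {T : Finset (Fin s)} (hT : T ∈ B) :
    minWeight B a ≤ setWeight a T :=
  setWeight_minSet_le a hT

lemma minWeight_mono (hne : B.Nonempty) {a b : Fin s →₀ ℕ} (h : a ≤ b) :
    minWeight B a ≤ minWeight B b :=
  (setWeight_minSet_le a (minSet_mem hne b)).trans (setWeight_mono h _)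

lemma minWeight_lt_iff (hne : B.Nonempty) (a : Fin s →₀ ℕ) (m : ℕ) :
    minWeight B a < 2 ^ s * m ↔ ∃ T ∈ B, ∑ i ∈ T, a i < m := by
  constructor
  · exact fun h => ⟨minSet B a, minSet_mem hne a, (setWeight_lt_iff a _ m).1 h⟩
  · rintro ⟨T, hT, h⟩
    exact (minWeight_le a hT).trans_lt ((setWeight_lt_iff a T m).2 h)

lemma minWeight_lt_add_single (hne : B.Nonempty) {a b : Fin s →₀ ℕ} (h : a ≤ b) {i : Fin s}
    (hi : i ∈ minSet B a) (hai : a i < b i) : minWeight B a < minWeight B b := by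
  by_cases e : minSet B b = minSet B a
  · rw [minWeight, minWeight, e]
    refine Finset.sum_lt_sum (fun j _ => ?_) ⟨i, hi, ?_⟩ <;> unfold expWeight
    · have := h j
      gcongr
    · gcongr
  · refine lt_of_le_of_ne (minWeight_mono hne h) fun e' => e ?_
    apply setWeight_injective a
    exact le_antisymm ((setWeight_mono h _).trans e'.ge) (setWeight_minSet_le a (minSet_mem hne b))

lemma roundExp_le (hne : B.Nonempty) (hB : SymmExchange B) {c : ℕ}
    (hcard : ∀ T ∈ B, T.card = c) (a : Fin s →₀ ℕ) : roundExp B a ≤ a :=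
  (minSet_eq_iff hB hcard (minSet_mem hne a)).1 rfl

lemma minSet_roundExp (hne : B.Nonempty) (hB : SymmExchange B) {c : ℕ}
    (hcard : ∀ T ∈ B, T.card = c) (a : Fin s →₀ ℕ) : minSet B (roundExp B a) = minSet B a :=
  (minSet_eq_iff hB hcard (minSet_mem hne a)).2 (roundOn_roundOn _ _).le

lemma minWeight_roundExp (hne : B.Nonempty) (hB : SymmExchange B) {c : ℕ}
    (hcard : ∀ T ∈ B, T.card = c) (a : Fin s →₀ ℕ) :
    minWeight B (roundExp B a) = minWeight B a := by
  rw [minWeight, minSet_roundExp hne hB hcard]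
  exact setWeight_congr fun i hi => roundOn_apply_of_mem a hi

lemma roundExp_roundExp (hne : B.Nonempty) (hB : SymmExchange B) {c : ℕ}
    (hcard : ∀ T ∈ B, T.card = c) (a : Fin s →₀ ℕ) : roundExp B (roundExp B a) = roundExp B a := by
  rw [roundExp, minSet_roundExp hne hB hcard]
  exact roundOn_roundOn _ _

lemma roundExp_eq_iff (hne : B.Nonempty) (hB : SymmExchange B) {c : ℕ}
    (hcard : ∀ T ∈ B, T.card = c) {u : Fin s →₀ ℕ} (hu : roundExp B u = u) (a : Fin s →₀ ℕ) :
    roundExp B a = u ↔ u ≤ a ∧ ∀ i ∈ minSet B u, a i = u i := by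
  constructor
  · rintro rfl
    refine ⟨roundExp_le hne hB hcard a, fun i hi => ?_⟩
    rw [minSet_roundExp hne hB hcard] at hi
    exact (roundOn_apply_of_mem a hi).symm
  · rintro ⟨h, h'⟩
    have e : roundOn B (minSet B u) a = u := (roundOn_congr h').trans hu
    have : minSet B a = minSet B u :=
      (minSet_eq_iff hB hcard (minSet_mem hne u)).2 (e.trans_le h)
    rw [roundExp, this, e]

lemma roundExp_apply_le {a : Fin s →₀ ℕ} {m : ℕ} (h : minWeight B a < 2 ^ s * m) (i : Fin s) :
    roundExp B a i ≤ m := by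
  have h' : ∀ t ∈ minSet B a, a t < m := fun t ht =>
    (Finset.single_le_sum (fun _ _ => Nat.zero_le _) ht).trans_lt ((setWeight_lt_iff a _ m).1 h)
  simp only [roundExp, roundOn, Finsupp.equivFunOnFinite_symm_apply_apply]
  split_ifs with hi
  · exact (h' i hi).le
  · refine Finset.sup_le fun t ht => ?_
    have := h' t (Finset.mem_filter.1 ht).1
    split_ifs <;> omega

lemma roundExp_filtration_step (hne : B.Nonempty) (hB : SymmExchange B) {c : ℕ}
    (hcard : ∀ T ∈ B, T.card = c) {Q : Set (Fin s →₀ ℕ) → Prop} (huniv : Q Set.univ)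
    (hstep : ∀ (U : Set (Fin s →₀ ℕ)) (u : Fin s →₀ ℕ), ∀ T ∈ B, IsUpperSet U →
      (∀ a, u ≤ a → (∀ i ∈ T, a i = u i) → a ∉ U) →
      (∀ i ∈ T, u + Finsupp.single i 1 ∈ U) →
      Q (U ∪ {a | u ≤ a ∧ ∀ i ∈ T, a i = u i}) → Q U) (D : Finset (Fin s →₀ ℕ))
    (hD : ∀ u ∈ D, roundExp B u = u) (hU : IsUpperSet {a | roundExp B a ∉ D}) :
    Q {a | roundExp B a ∉ D} := by
  induction hn : D.card generalizing D with
  | zero =>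
    rw [Finset.card_eq_zero] at hn
    simpa [hn] using huniv
  | succ n ih =>
    obtain ⟨u, huD, hmax⟩ := D.exists_max_image (minWeight B)
      (Finset.card_pos.1 (hn.symm ▸ Nat.succ_pos n))
    have hu := hD u huD
    have key : ∀ b, u ≤ b → ∀ i ∈ minSet B u, b i ≠ u i → roundExp B b ∉ D := by
      intro b hb i hi hne' hbD
      have h1 := hmax _ hbD
      rw [minWeight_roundExp hne hB hcard] at h1
      exact h1.not_gt (minWeight_lt_add_single hne hb hi (lt_of_le_of_ne (hb i) (Ne.symm hne')))
    have hset : {a | roundExp B a ∉ D.erase u} =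
        {a | roundExp B a ∉ D} ∪ {a | u ≤ a ∧ ∀ i ∈ minSet B u, a i = u i} := by
      ext a
      simp only [Set.mem_ofPred_eq, Set.mem_union, ← roundExp_eq_iff hne hB hcard hu,
        Finset.mem_erase]
      tauto
    refine hstep _ u (minSet B u) (minSet_mem hne u) hU ?_ ?_ ?_
    · intro a h1 h2
      simp only [Set.mem_ofPred_eq, not_not,
        (roundExp_eq_iff hne hB hcard hu a).2 ⟨h1, h2⟩, huD]
    · intro i hi
      exact key _ (le_add_of_nonneg_right zero_le) i hi (by simp)
    · rw [← hset]
      refine ih _ (fun v hv => hD v (Finset.mem_of_mem_erase hv)) ?_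
        (by rw [Finset.card_erase_of_mem huD, hn]; rfl)
      rw [hset]
      rintro a b hab (ha | ⟨ha, ha'⟩)
      · exact Or.inl (hU hab ha)
      · by_cases h : ∀ i ∈ minSet B u, b i = u i
        · exact Or.inr ⟨ha.trans hab, h⟩
        · push Not at h
          obtain ⟨i, hi, h⟩ := h
          exact Or.inl (key b (ha.trans hab) i hi h)

/-- The exponents of the intersection of the `m`-th powers of the monomial primes given by `B`
can be reached from all exponents by successively removing translated orthants. -/
theorem orthant_filtration (hne : B.Nonempty) (hB : SymmExchange B) {c : ℕ}
    (hcard : ∀ T ∈ B, T.card = c) (m : ℕ) {Q : Set (Fin s →₀ ℕ) → Prop} (huniv : Q Set.univ)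
    (hstep : ∀ (U : Set (Fin s →₀ ℕ)) (u : Fin s →₀ ℕ), ∀ T ∈ B, IsUpperSet U →
      (∀ a, u ≤ a → (∀ i ∈ T, a i = u i) → a ∉ U) →
      (∀ i ∈ T, u + Finsupp.single i 1 ∈ U) →
      Q (U ∪ {a | u ≤ a ∧ ∀ i ∈ T, a i = u i}) → Q U) :
    Q {a | ∀ T ∈ B, m ≤ ∑ i ∈ T, a i} := by
  have hfin : (roundExp B '' {a | minWeight B a < 2 ^ s * m}).Finite := by
    refine (Set.finite_Iic (Finsupp.equivFunOnFinite.symm fun _ => m)).subset ?_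
    rintro _ ⟨a, ha, rfl⟩ i
    exact roundExp_apply_le ha i
  have hset : {a | ∀ T ∈ B, m ≤ ∑ i ∈ T, a i} = {a | roundExp B a ∉ hfin.toFinset} := by
    ext a
    rw [← not_iff_not]
    simp only [Set.mem_ofPred_eq, not_forall, not_le, exists_prop, Set.Finite.mem_toFinset,
      not_not, ← minWeight_lt_iff hne]
    constructor
    · exact fun h => ⟨a, h, rfl⟩
    · rintro ⟨b, hb, e⟩
      rwa [← minWeight_roundExp hne hB hcard, ← e, minWeight_roundExp hne hB hcard]
  rw [hset]
  refine roundExp_filtration_step hne hB hcard huniv hstep _ ?_ ?_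
  · intro u hu
    obtain ⟨a, -, rfl⟩ := hfin.mem_toFinset.1 hu
    exact roundExp_roundExp hne hB hcard a
  · rw [← hset]
    exact fun a b hab ha T hT => (ha T hT).trans (Finset.sum_le_sum fun i _ => hab i)

end MinimalWeight

section Matroid

lemma Matroid.IsBase.symm_exchange {α : Type*} {M : Matroid α} {F F' : Set α} {t : α}
    (hF : M.IsBase F) (hF' : M.IsBase F') (ht : t ∈ F') (htF : t ∉ F) :
    ∃ i ∈ F, i ∉ F' ∧ M.IsBase (insert t F \ {i}) ∧ M.IsBase (insert i F' \ {t}) := by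
  have htE : t ∈ M.E := hF'.subset_ground ht
  have hC := hF.fundCircuit_isCircuit htE htF
  have hK := M.fundCocircuit_isCocircuit ht hF'
  obtain ⟨i, ⟨hiC, hiK⟩, hit⟩ := (hC.isCocircuit_inter_nontrivial hK
    ⟨t, M.mem_fundCircuit t F, M.mem_fundCocircuit t F'⟩).exists_ne t
  have hiF : i ∈ F := ((M.fundCircuit_subset_insert t F) hiC).resolve_left hit
  have hiF' : i ∉ F' := fun h =>
    hit ((M.fundCocircuit_inter_eq ht).subset ⟨hiK, h⟩)
  have hiE : i ∈ M.E := hF.subset_ground hiF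
  rw [hF.indep.mem_fundCircuit_iff (by rwa [hF.closure_eq]) htF] at hiC
  rw [hF'.mem_fundCocircuit_iff_mem_fundCircuit,
    hF'.indep.mem_fundCircuit_iff (by rwa [hF'.closure_eq]) hiF'] at hiK
  exact ⟨i, hiF, hiF', hF.exchange_isBase_of_indep' hiF htF hiC,
    hF'.exchange_isBase_of_indep' ht hiF' hiK⟩

variable {s : ℕ} {Δ : Finset (Fin s) → Prop}

/-- The matroid with independent sets the faces of `Δ`. -/
def IsMatroid.toMatroid (h : IsMatroid Δ) : Matroid (Fin s) :=
  (IndepMatroid.ofFinset Set.univ Δ h.1 (fun _ _ hJ hI => h.2.1 _ _ hJ hI)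
    (fun I J hI hJ hc => h.2.2 J I hJ hI hc) fun _ _ => Set.subset_univ _).matroid

lemma IsMatroid.toMatroid_indep (h : IsMatroid Δ) (F : Finset (Fin s)) :
    h.toMatroid.Indep F ↔ Δ F :=
  IndepMatroid.ofFinset_indep Set.univ Δ h.1 (fun _ _ hJ hI => h.2.1 _ _ hJ hI)
    (fun I J hI hJ hc => h.2.2 J I hJ hI hc) fun _ _ => Set.subset_univ _

lemma IsMatroid.toMatroid_isBase (h : IsMatroid Δ) (F : Finset (Fin s)) :
    h.toMatroid.IsBase F ↔ IsBasisOf Δ F := by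
  rw [Matroid.isBase_iff_maximal_indep, maximal_iff, h.toMatroid_indep]
  refine and_congr_right fun _ => ⟨fun hF G hG hFG => ?_, fun hF G hG hFG => ?_⟩
  · exact (Finset.coe_injective (hF ((h.toMatroid_indep G).2 hG) (Finset.coe_subset.2 hFG))).symm
  · obtain ⟨G, rfl⟩ := G.toFinite.exists_finset_coe
    rw [hF G ((h.toMatroid_indep G).1 hG) (Finset.coe_subset.1 hFG)]

open Classical in
/-- The complements of the bases. -/
noncomputable def cobases (Δ : Finset (Fin s) → Prop) : Finset (Finset (Fin s)) :=
  Finset.univ.filter fun T => IsBasisOf Δ Tᶜ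

lemma mem_cobases {T : Finset (Fin s)} : T ∈ cobases Δ ↔ IsBasisOf Δ Tᶜ := by
  simp [cobases]

lemma IsMatroid.cobases_nonempty (h : IsMatroid Δ) : (cobases Δ).Nonempty := by
  obtain ⟨F, hF⟩ := h.toMatroid.exists_isBase
  obtain ⟨F, rfl⟩ := F.toFinite.exists_finset_coe
  exact ⟨Fᶜ, mem_cobases.2 (by rwa [compl_compl, ← h.toMatroid_isBase])⟩

lemma IsMatroid.symmExchange_cobases (h : IsMatroid Δ) : SymmExchange (cobases Δ) := by
  intro T hT T' hT' t ht ht'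
  rw [mem_cobases, ← h.toMatroid_isBase] at hT hT'
  obtain ⟨i, hi, hi', h1, h2⟩ := hT.symm_exchange hT' (t := t) (by simpa) (by simpa)
  simp only [Finset.coe_compl, Set.mem_compl_iff, SetLike.mem_coe, not_not] at hi hi'
  refine ⟨i, hi', hi, ?_, ?_⟩ <;> rw [mem_cobases, ← h.toMatroid_isBase]
  · convert h1 using 1
    ext j
    simp
  · convert h2 using 1
    ext j
    simp

end Matroid

section MonomialIdeal

variable {s : ℕ} {k : Type} [Field k]

variable (k) in
/-- The ideal generated by the monomials with exponents in `U`. -/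
noncomputable def monomialIdeal (U : Set (Fin s →₀ ℕ)) : Ideal (MvPolynomial (Fin s) k) :=
  Ideal.span ((fun a => monomial a (1 : k)) '' U)

lemma mem_monomialIdeal {U : Set (Fin s →₀ ℕ)} (hU : IsUpperSet U)
    {p : MvPolynomial (Fin s) k} : p ∈ monomialIdeal k U ↔ ∀ a ∈ p.support, a ∈ U := by
  rw [monomialIdeal, mem_ideal_span_monomial_image]
  exact forall₂_congr fun a _ => ⟨fun ⟨b, hb, hba⟩ => hU hba hb, fun ha => ⟨a, ha, le_rfl⟩⟩

lemma monomial_mem_monomialIdeal {U : Set (Fin s →₀ ℕ)} {a : Fin s →₀ ℕ} (ha : a ∈ U) :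
    monomial a (1 : k) ∈ monomialIdeal k U :=
  Ideal.subset_span ⟨a, ha, rfl⟩

lemma monomialIdeal_le_iff {U : Set (Fin s →₀ ℕ)} {K : Ideal (MvPolynomial (Fin s) k)} :
    monomialIdeal k U ≤ K ↔ ∀ a ∈ U, monomial a (1 : k) ∈ K := by
  rw [monomialIdeal, Ideal.span_le, Set.image_subset_iff]
  rfl

lemma monomialIdeal_univ : monomialIdeal k (Set.univ : Set (Fin s →₀ ℕ)) = ⊤ :=
  (Ideal.eq_top_iff_one _).2 (monomial_mem_monomialIdeal (Set.mem_univ 0))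

lemma monomialIdeal_union_orthant (U : Set (Fin s →₀ ℕ)) (u : Fin s →₀ ℕ)
    (T : Finset (Fin s)) :
    monomialIdeal k (U ∪ {a | u ≤ a ∧ ∀ i ∈ T, a i = u i}) =
      monomialIdeal k U ⊔ Ideal.span {monomial u 1} := by
  apply le_antisymm
  · rw [monomialIdeal_le_iff]
    rintro a (ha | ⟨ha, -⟩)
    · exact Ideal.mem_sup_left (monomial_mem_monomialIdeal ha)
    · refine Ideal.mem_sup_right (Ideal.mem_span_singleton.2 ?_)
      exact monomial_dvd_monomial.2 ⟨Or.inr ha, dvd_rfl⟩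
  · rw [sup_le_iff, monomialIdeal_le_iff, Ideal.span_singleton_le_iff_mem]
    exact ⟨fun a ha => monomial_mem_monomialIdeal (Or.inl ha),
      monomial_mem_monomialIdeal (Or.inr ⟨le_rfl, fun _ _ => rfl⟩)⟩

lemma monomial_mul_mem_monomialIdeal_iff {U : Set (Fin s →₀ ℕ)} {u : Fin s →₀ ℕ}
    {T : Finset (Fin s)} (hU : IsUpperSet U)
    (hdisj : ∀ a, u ≤ a → (∀ i ∈ T, a i = u i) → a ∉ U)
    (hadd : ∀ i ∈ T, u + Finsupp.single i 1 ∈ U) (p : MvPolynomial (Fin s) k) :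
    monomial u 1 * p ∈ monomialIdeal k U ↔
      p ∈ Ideal.span ((X : Fin s → MvPolynomial (Fin s) k) '' ↑T) := by
  rw [mem_monomialIdeal hU, mem_ideal_span_X_image]
  constructor
  · intro h a ha
    by_contra! h'
    refine hdisj (u + a) (le_add_of_nonneg_right zero_le) (fun i hi => ?_) (h _ ?_)
    · simp [h' i hi]
    · rw [mem_support_iff, coeff_monomial_mul]
      simpa using ha
  · intro h b hb
    rw [mem_support_iff, coeff_monomial_mul'] at hb
    split_ifs at hb with hub
    · obtain ⟨i, hi, hne⟩ := h (b - u) (by simpa using hb)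
      refine hU ?_ (hadd i hi)
      rw [← add_tsub_cancel_of_le hub]
      gcongr
      exact Finsupp.single_le_iff.2 (Nat.one_le_iff_ne_zero.2 hne)
    · exact absurd rfl hb

lemma sum_single_one_of_mem {T : Finset (Fin s)} {i : Fin s} (hi : i ∈ T) :
    ∑ j ∈ T, Finsupp.single i 1 j = 1 := by
  rw [Finset.sum_eq_single_of_mem i hi fun j _ hj => Finsupp.single_eq_of_ne hj,
    Finsupp.single_eq_same]

lemma span_X_image_pow_eq (T : Finset (Fin s)) (m : ℕ) :
    Ideal.span ((X : Fin s → MvPolynomial (Fin s) k) '' ↑T) ^ m =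
      monomialIdeal k {a | m ≤ ∑ i ∈ T, a i} := by
  induction m with
  | zero => simpa [Ideal.one_eq_top] using monomialIdeal_univ.symm
  | succ m ih =>
    rw [pow_succ, ih]
    apply le_antisymm
    · rw [monomialIdeal, Ideal.span_mul_span', Ideal.span_le]
      rintro _ ⟨_, ⟨a, ha, rfl⟩, _, ⟨i, hi, rfl⟩, rfl⟩
      have : monomial a (1 : k) * X i = monomial (a + Finsupp.single i 1) 1 := by
        rw [X, monomial_mul, one_mul]
      change monomial a (1 : k) * X i ∈ _
      rw [this]
      refine monomial_mem_monomialIdeal ?_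
      have h := sum_single_one_of_mem hi
      simp only [Set.mem_ofPred_eq, Finsupp.add_apply, Finset.sum_add_distrib, h] at ha ⊢
      omega
    · rw [monomialIdeal_le_iff]
      intro a ha
      obtain ⟨i, hi, hai⟩ : ∃ i ∈ T, a i ≠ 0 := by
        by_contra! h
        rw [Set.mem_ofPred_eq, Finset.sum_eq_zero h] at ha
        omega
      have hle : Finsupp.single i 1 ≤ a := Finsupp.single_le_iff.2 (Nat.one_le_iff_ne_zero.2 hai)
      have : monomial a (1 : k) = monomial (a - Finsupp.single i 1) 1 * X i := by
        rw [X, monomial_mul, one_mul, tsub_add_cancel_of_le hle]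
      rw [this]
      refine Ideal.mul_mem_mul (monomial_mem_monomialIdeal ?_) (Ideal.subset_span ⟨i, hi, rfl⟩)
      have h := sum_single_one_of_mem hi
      have h' : ∑ j ∈ T, a j = ∑ j ∈ T, (a - Finsupp.single i 1 : Fin s →₀ ℕ) j +
          ∑ j ∈ T, Finsupp.single i 1 j := by
        rw [← Finset.sum_add_distrib]
        refine Finset.sum_congr rfl fun j _ => ?_
        rw [← Finsupp.add_apply, tsub_add_cancel_of_le hle]
      simp only [Set.mem_ofPred_eq] at ha ⊢
      omega

lemma iInf_span_X_image_pow_eq (B : Finset (Finset (Fin s))) (m : ℕ) :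
    ⨅ T ∈ B, Ideal.span ((X : Fin s → MvPolynomial (Fin s) k) '' ↑T) ^ m =
      monomialIdeal k {a | ∀ T ∈ B, m ≤ ∑ i ∈ T, a i} := by
  have hup (T : Finset (Fin s)) : IsUpperSet {a : Fin s →₀ ℕ | m ≤ ∑ i ∈ T, a i} :=
    fun a b hab ha => ha.trans (Finset.sum_le_sum fun i _ => hab i)
  have hup' : IsUpperSet {a : Fin s →₀ ℕ | ∀ T ∈ B, m ≤ ∑ i ∈ T, a i} :=
    fun a b hab ha T hT => hup T hab (ha T hT)
  ext p
  simp only [Ideal.mem_iInf, span_X_image_pow_eq, mem_monomialIdeal (hup _),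
    mem_monomialIdeal hup', Set.mem_ofPred_eq]
  exact ⟨fun h a ha T hT => h T hT a ha, fun h a ha T hT => h T hT a ha⟩

/-- The intersection of the `m`-th powers of the monomial primes `(X i : i ∈ T)`, `T ∈ B`, has a
filtration with quotients `S ⧸ (X i : i ∈ T)`. -/
theorem iInf_span_X_image_pow_induction {B : Finset (Finset (Fin s))} (hne : B.Nonempty)
    (hB : SymmExchange B) {c : ℕ} (hcard : ∀ T ∈ B, T.card = c) (m : ℕ)
    {Q : Ideal (MvPolynomial (Fin s) k) → Prop} (htop : Q ⊤)
    (hstep : ∀ T ∈ B, ∀ (K : Ideal (MvPolynomial (Fin s) k)) (u : MvPolynomial (Fin s) k),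
      (∀ p, u * p ∈ K ↔ p ∈ Ideal.span ((X : Fin s → MvPolynomial (Fin s) k) '' ↑T)) →
        Q (K ⊔ Ideal.span {u}) → Q K) :
    Q (⨅ T ∈ B, Ideal.span ((X : Fin s → MvPolynomial (Fin s) k) '' ↑T) ^ m) := by
  rw [iInf_span_X_image_pow_eq]
  refine orthant_filtration (Q := fun U => Q (monomialIdeal k U)) hne hB hcard m ?_ ?_
  · rwa [monomialIdeal_univ]
  · intro U u T hT hU hdisj hadd h
    rw [monomialIdeal_union_orthant] at h
    exact hstep T hT _ _ (monomial_mul_mem_monomialIdeal_iff hU hdisj hadd) h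

end MonomialIdeal

section Colon

variable {A : Type} [CommRing A] {K P : Ideal A} {u : A}

/-- Multiplication by `u` as a map `A ⧸ (K : u) → A ⧸ K`. -/
def colonMap (h : ∀ p, u * p ∈ K ↔ p ∈ P) : (A ⧸ P) →ₗ[A] A ⧸ K :=
  Submodule.mapQ P K (LinearMap.mulLeft A u) fun p hp => (h p).2 hp

lemma colonMap_mk (h : ∀ p, u * p ∈ K ↔ p ∈ P) (p : A) :
    colonMap h (Ideal.Quotient.mk P p) = Ideal.Quotient.mk K (u * p) :=
  rfl

lemma colonMap_injective (h : ∀ p, u * p ∈ K ↔ p ∈ P) : Function.Injective (colonMap h) := by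
  rw [injective_iff_map_eq_zero]
  intro x hx
  obtain ⟨p, rfl⟩ := Ideal.Quotient.mk_surjective x
  rw [colonMap_mk, Ideal.Quotient.eq_zero_iff_mem, h] at hx
  exact Ideal.Quotient.eq_zero_iff_mem.2 hx

variable (K u) in
/-- The projection `A ⧸ K → A ⧸ (K + (u))`. -/
def supMap : (A ⧸ K) →ₗ[A] A ⧸ (K ⊔ Ideal.span {u}) :=
  Submodule.factor le_sup_left

lemma supMap_mk (p : A) : supMap K u (Ideal.Quotient.mk K p) = Ideal.Quotient.mk _ p :=
  rfl

lemma supMap_surjective : Function.Surjective (supMap K u) := fun x => by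
  obtain ⟨p, rfl⟩ := Ideal.Quotient.mk_surjective x
  exact ⟨Ideal.Quotient.mk K p, rfl⟩

lemma colonMap_exact_supMap (h : ∀ p, u * p ∈ K ↔ p ∈ P) :
    Function.Exact (colonMap h) (supMap K u) := by
  intro x
  obtain ⟨a, rfl⟩ := Ideal.Quotient.mk_surjective x
  rw [supMap_mk, Ideal.Quotient.eq_zero_iff_mem]
  constructor
  · intro ha
    obtain ⟨b, hb, q, hq, rfl⟩ := Submodule.mem_sup.1 ha
    obtain ⟨p, rfl⟩ := Ideal.mem_span_singleton'.1 hq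
    refine ⟨Ideal.Quotient.mk P p, ?_⟩
    rw [colonMap_mk, Ideal.Quotient.mk_eq_mk_iff_sub_mem, ← neg_mem_iff]
    convert hb using 1
    ring
  · rintro ⟨y, hy⟩
    obtain ⟨p, rfl⟩ := Ideal.Quotient.mk_surjective y
    rw [colonMap_mk, Ideal.Quotient.mk_eq_mk_iff_sub_mem] at hy
    refine Submodule.mem_sup.2 ⟨a - u * p, by rw [← neg_mem_iff]; simpa using hy, p * u,
      Ideal.mem_span_singleton'.2 ⟨p, rfl⟩, by ring⟩

end Colon

section

variable {S R : Type} [CommRing S] [CommRing R] [Algebra S R]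

lemma tmul_mk_one_eq_zero_iff (P : Ideal S) (r : R) :
    r ⊗ₜ[S] (1 : S ⧸ P) = 0 ↔ r ∈ P.map (algebraMap S R) := by
  rw [← Algebra.TensorProduct.quotIdealMapEquivTensorQuot_mk, EmbeddingLike.map_eq_zero_iff]
  exact Ideal.Quotient.eq_zero_iff_mem

lemma tmul_mk_eq (P : Ideal S) (r : R) (p : S) :
    r ⊗ₜ[S] (Ideal.Quotient.mk P p) = (algebraMap S R p * r) ⊗ₜ[S] (1 : S ⧸ P) := by
  rw [← Algebra.smul_def, TensorProduct.smul_tmul, Algebra.smul_def, mul_one]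
  rfl

lemma exists_eq_tmul_one (P : Ideal S) (x : R ⊗[S] (S ⧸ P)) : ∃ r : R, x = r ⊗ₜ[S] 1 := by
  obtain ⟨r, rfl⟩ := (Algebra.TensorProduct.quotIdealMapEquivTensorQuot R P).surjective x
  obtain ⟨r, rfl⟩ := Ideal.Quotient.mk_surjective r
  exact ⟨r, rfl⟩

lemma baseChange_colonMap_injective_iff {K P : Ideal S} {u : S} (h : ∀ p, u * p ∈ K ↔ p ∈ P) :
    Function.Injective ((colonMap h).baseChange R) ↔
      ∀ r, algebraMap S R u * r ∈ K.map (algebraMap S R) → r ∈ P.map (algebraMap S R) := by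
  have key (r : R) : (colonMap h).baseChange R (r ⊗ₜ[S] 1) =
      (algebraMap S R u * r) ⊗ₜ[S] (1 : S ⧸ K) := by
    rw [LinearMap.baseChange_tmul, ← map_one (Ideal.Quotient.mk P), colonMap_mk, mul_one,
      tmul_mk_eq]
  rw [injective_iff_map_eq_zero]
  constructor
  · intro H r hr
    rw [← tmul_mk_one_eq_zero_iff] at hr ⊢
    exact H _ ((key r).trans hr)
  · intro H x hx
    obtain ⟨r, rfl⟩ := exists_eq_tmul_one P x
    rw [key, tmul_mk_one_eq_zero_iff] at hx
    exact (tmul_mk_one_eq_zero_iff P r).2 (H r hx)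

/-- Colon ideals extend along `S → R` under vanishing of Tor. -/
lemma TorAcyclic.mul_mem_map_iff {K P : Ideal S} {u : S} (h : ∀ p, u * p ∈ K ↔ p ∈ P)
    (hL : TorAcyclic (ModuleCat.of S (S ⧸ K ⊔ Ideal.span {u})) (ModuleCat.of S R)) (r : R) :
    algebraMap S R u * r ∈ K.map (algebraMap S R) ↔ r ∈ P.map (algebraMap S R) := by
  refine ⟨(baseChange_colonMap_injective_iff h).1 (hL.baseChange_injective
    (colonMap_injective h) (colonMap_exact_supMap h) supMap_surjective) r, fun hr => ?_⟩
  have hle : Ideal.span {u} * P ≤ K := by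
    rw [Ideal.span_singleton_mul_le_iff]
    exact fun p hp => (h p).2 hp
  have := Ideal.map_mono (f := algebraMap S R) hle
  rw [Ideal.map_mul, Ideal.map_span, Set.image_singleton, Ideal.span_singleton_mul_le_iff] at this
  exact this r hr

lemma TorAcyclic.of_colon {K P : Ideal S} {u : S} (h : ∀ p, u * p ∈ K ↔ p ∈ P)
    (hP : TorAcyclic (ModuleCat.of S (S ⧸ P)) (ModuleCat.of S R))
    (hL : TorAcyclic (ModuleCat.of S (S ⧸ K ⊔ Ideal.span {u})) (ModuleCat.of S R)) :
    TorAcyclic (ModuleCat.of S (S ⧸ K)) (ModuleCat.of S R) :=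
  TorAcyclic.middle (ModuleCat.shortExact_of_exact (colonMap_injective h)
    (colonMap_exact_supMap h) supMap_surjective) hP hL

lemma TorAcyclic.sup_span_singleton {K : Ideal S} {u : S} (h : ∀ p, u * p ∈ K ↔ p ∈ K)
    (hK : TorAcyclic (ModuleCat.of S (S ⧸ K)) (ModuleCat.of S R))
    (hR : ∀ r, algebraMap S R u * r ∈ K.map (algebraMap S R) → r ∈ K.map (algebraMap S R)) :
    TorAcyclic (ModuleCat.of S (S ⧸ K ⊔ Ideal.span {u})) (ModuleCat.of S R) :=
  TorAcyclic.right (ModuleCat.shortExact_of_exact (colonMap_injective h)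
    (colonMap_exact_supMap h) supMap_surjective) hK hK ((ModuleCat.mono_iff_injective _).2
      ((LinearMap.lTensor_inj_iff_rTensor_inj R _).1
        ((baseChange_colonMap_injective_iff h).2 hR)))

end

section Regular

lemma ofList_map_smul_top {A ι : Type*} [CommRing A] [DecidableEq ι] (f : ι → A) (l : List ι) :
    (Ideal.ofList (l.map f) • ⊤ : Submodule A A) = Ideal.span (f '' ↑l.toFinset) := by
  rw [smul_eq_mul, Ideal.mul_top, Ideal.ofList]
  congr 1
  ext x
  simp

lemma SubsetsRegular.mem_of_mul_mem {R : Type} [CommRing R] {s c : ℕ} {f : Fin s → R}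
    (h : SubsetsRegular f (c + 1)) {T : Finset (Fin s)} {j : Fin s} (hj : j ∉ T)
    (hT : T.card ≤ c) {r : R} (hr : f j * r ∈ Ideal.span (f '' ↑T)) :
    r ∈ Ideal.span (f '' ↑T) := by
  have hreg := (h (T.toList ++ [j]) (by simp [List.nodup_append, T.nodup_toList, hj])
    (by simpa)).1
  rw [List.map_append, RingTheory.Sequence.isWeaklyRegular_append_iff, List.map_singleton,
    RingTheory.Sequence.isWeaklyRegular_singleton_iff] at hreg
  rw [ofList_map_smul_top, Finset.toList_toFinset] at hreg
  refine (Submodule.Quotient.mk_eq_zero _).1 (hreg.2 (a₁ := Submodule.Quotient.mk r) (a₂ := 0) ?_)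
  exact ((Submodule.Quotient.mk_eq_zero _).2 hr).trans (smul_zero _).symm

end Regular

section VariablePrimes

variable {k : Type} [Field k] {s : ℕ}

lemma X_mul_mem_span_X_image_iff {T : Finset (Fin s)} {j : Fin s} (hj : j ∉ T)
    (p : MvPolynomial (Fin s) k) :
    X j * p ∈ Ideal.span ((X : Fin s → MvPolynomial (Fin s) k) '' ↑T) ↔
      p ∈ Ideal.span ((X : Fin s → MvPolynomial (Fin s) k) '' ↑T) := by
  refine ⟨fun h => ?_, Ideal.mul_mem_left _ _⟩
  rw [mem_ideal_span_X_image] at h ⊢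
  intro a ha
  obtain ⟨i, hi, hne⟩ := h (Finsupp.single j 1 + a) (by
    rw [support_X_mul, Finset.mem_map]
    exact ⟨a, ha, rfl⟩)
  refine ⟨i, hi, ?_⟩
  rwa [Finsupp.add_apply, Finsupp.single_eq_of_ne (by rintro rfl; exact hj hi), zero_add] at hne

lemma span_image_insert {A : Type*} [CommRing A] (f : Fin s → A) (T : Finset (Fin s))
    (j : Fin s) :
    Ideal.span (f '' ↑(insert j T)) = Ideal.span (f '' ↑T) ⊔ Ideal.span {f j} := by
  rw [Finset.coe_insert, Set.image_insert_eq, Ideal.span_insert, sup_comm]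

variable {R : Type} [CommRing R] [Algebra (MvPolynomial (Fin s) k) R]

variable (k R) in
lemma map_span_X_image (T : Finset (Fin s)) :
    (Ideal.span ((X : Fin s → MvPolynomial (Fin s) k) '' ↑T)).map
      (algebraMap (MvPolynomial (Fin s) k) R) =
      Ideal.span ((fun i => algebraMap (MvPolynomial (Fin s) k) R (X i)) '' ↑T) := by
  rw [Ideal.map_span, Set.image_image]

variable {c : ℕ}

lemma SubsetsRegular.torAcyclic
    (h : SubsetsRegular (fun i => algebraMap (MvPolynomial (Fin s) k) R (X i)) (c + 1))
    (T : Finset (Fin s)) (hT : T.card ≤ c) :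
    TorAcyclic (ModuleCat.of (MvPolynomial (Fin s) k) (MvPolynomial (Fin s) k ⧸
      Ideal.span ((X : Fin s → MvPolynomial (Fin s) k) '' ↑T)))
      (ModuleCat.of (MvPolynomial (Fin s) k) R) := by
  induction T using Finset.induction_on with
  | empty =>
    have e : (MvPolynomial (Fin s) k ⧸
        Ideal.span ((X : Fin s → MvPolynomial (Fin s) k) '' ↑(∅ : Finset (Fin s)))) ≃ₗ[
          MvPolynomial (Fin s) k] MvPolynomial (Fin s) k :=
      Submodule.quotEquivOfEqBot _ (by simp)
    have := Module.Flat.of_linearEquiv e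
    exact torAcyclic_of_flat _ _
  | insert j T hj ih =>
    rw [Finset.card_insert_of_notMem hj] at hT
    rw [span_image_insert]
    refine TorAcyclic.sup_span_singleton (X_mul_mem_span_X_image_iff hj) (ih (by omega)) ?_
    intro r hr
    rw [map_span_X_image] at hr ⊢
    exact h.mem_of_mul_mem hj (by omega) hr

lemma SubsetsRegular.mem_of_prod_pow_mul_mem
    (h : SubsetsRegular (fun i => algebraMap (MvPolynomial (Fin s) k) R (X i)) (c + 1))
    {T : Finset (Fin s)} (hT : T.card ≤ c) (m : ℕ) {r : R}
    (hr : algebraMap _ R (∏ i ∈ Tᶜ, (X i : MvPolynomial (Fin s) k)) ^ m * r ∈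
      (Ideal.span ((X : Fin s → MvPolynomial (Fin s) k) '' ↑T)).map (algebraMap _ R)) :
    r ∈ (Ideal.span ((X : Fin s → MvPolynomial (Fin s) k) '' ↑T)).map (algebraMap _ R) := by
  rw [map_span_X_image, map_prod] at *
  have key (U : Finset (Fin s)) (hU : Disjoint U T) (r : R)
      (hr : (∏ i ∈ U, algebraMap (MvPolynomial (Fin s) k) R (X i)) * r ∈
        Ideal.span ((fun i => algebraMap (MvPolynomial (Fin s) k) R (X i)) '' ↑T)) :
      r ∈ Ideal.span ((fun i => algebraMap (MvPolynomial (Fin s) k) R (X i)) '' ↑T) := by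
    induction U using Finset.induction_on with
    | empty => simpa using hr
    | insert j U hj ih =>
      rw [Finset.disjoint_insert_left] at hU
      rw [Finset.prod_insert hj, mul_assoc] at hr
      exact ih hU.2 (h.mem_of_mul_mem hU.1 hT hr)
  induction m with
  | zero => simpa using hr
  | succ m ih =>
    rw [pow_succ', mul_assoc] at hr
    exact ih (key _ disjoint_compl_left _ hr)

end VariablePrimes

section Descent

variable {S R : Type} [CommRing S] [CommRing R] [Algebra S R]

/-- An extended ideal is saturated with respect to a set of elements of the base. -/
def SaturatedMap (R : Type) [CommRing R] [Algebra S R] (G : Set S) (K : Ideal S) : Prop :=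
  ∀ r : R, (∀ g ∈ G, algebraMap S R g * r ∈ K.map (algebraMap S R)) → r ∈ K.map (algebraMap S R)

lemma SaturatedMap.of_colon {G : Set S} {K P : Ideal S} {u : S} (h : ∀ p, u * p ∈ K ↔ p ∈ P)
    (hL : TorAcyclic (ModuleCat.of S (S ⧸ K ⊔ Ideal.span {u})) (ModuleCat.of S R))
    (hGP : SaturatedMap R G P) (hGL : SaturatedMap R G (K ⊔ Ideal.span {u})) :
    SaturatedMap R G K := by
  intro r hr
  have hrL := hGL r fun g hg => Ideal.map_mono le_sup_left (hr g hg)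
  rw [Ideal.map_sup, Ideal.map_span, Set.image_singleton] at hrL
  obtain ⟨a, ha, b, hb, rfl⟩ := Submodule.mem_sup.1 hrL
  obtain ⟨b, rfl⟩ := Ideal.mem_span_singleton'.1 hb
  refine add_mem ha ?_
  rw [mul_comm, hL.mul_mem_map_iff h]
  refine hGP b fun g hg => ?_
  rw [← hL.mul_mem_map_iff h]
  have := sub_mem (hr g hg) (Ideal.mul_mem_left _ (algebraMap S R g) ha)
  convert this using 1
  ring

end Descent

section ExtVanishing

variable {A : Type} [CommRing A]

/-- Vanishing of `Ext i N M` for `i < t`. -/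
def ExtVanishes (N M : Type) [AddCommGroup N] [Module A N] [AddCommGroup M] [Module A M]
    (t : ℕ) : Prop :=
  ∀ i < t, Subsingleton (Abelian.Ext (ModuleCat.of A N) (ModuleCat.of A M) i)

variable {N : Type} [AddCommGroup N] [Module A N]

section

variable {M₁ M₂ M₃ : Type} [AddCommGroup M₁] [AddCommGroup M₂] [AddCommGroup M₃] [Module A M₁]
  [Module A M₂] [Module A M₃] {f : M₁ →ₗ[A] M₂} {g : M₂ →ₗ[A] M₃} {t : ℕ}

lemma ExtVanishes.middle (hf : Function.Injective f) (hfg : Function.Exact f g)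
    (hg : Function.Surjective g) (h₁ : ExtVanishes (A := A) N M₁ t)
    (h₃ : ExtVanishes (A := A) N M₃ t) : ExtVanishes (A := A) N M₂ t := fun i hi =>
  AddCommGrpCat.subsingleton_of_isZero <| ShortComplex.Exact.isZero_of_both_zeros
    (Abelian.Ext.covariant_sequence_exact₂' (ModuleCat.of A N)
      (ModuleCat.shortExact_of_exact hf hfg hg) i)
    ((AddCommGrpCat.isZero_of_iff_subsingleton.2 (h₁ i hi)).eq_zero_of_src _)
    ((AddCommGrpCat.isZero_of_iff_subsingleton.2 (h₃ i hi)).eq_zero_of_tgt _)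

lemma ExtVanishes.right (hf : Function.Injective f) (hfg : Function.Exact f g)
    (hg : Function.Surjective g) (h₁ : ExtVanishes (A := A) N M₁ (t + 1))
    (h₂ : ExtVanishes (A := A) N M₂ (t + 1)) : ExtVanishes (A := A) N M₃ t := fun i hi =>
  AddCommGrpCat.subsingleton_of_isZero <| ShortComplex.Exact.isZero_of_both_zeros
    (Abelian.Ext.covariant_sequence_exact₃' (ModuleCat.of A N)
      (ModuleCat.shortExact_of_exact hf hfg hg) i (i + 1) rfl)
    ((AddCommGrpCat.isZero_of_iff_subsingleton.2 (h₂ i (by omega))).eq_zero_of_src _)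
    ((AddCommGrpCat.isZero_of_iff_subsingleton.2 (h₁ (i + 1) (by omega))).eq_zero_of_tgt _)

end

lemma ExtVanishes.of_subsingleton (M : Type) [AddCommGroup M] [Module A M] [Subsingleton M]
    (t : ℕ) : ExtVanishes (A := A) N M t := fun i _ => by
  have h0 : 𝟙 (ModuleCat.of A M) = 0 := (ModuleCat.isZero_of_subsingleton _).eq_of_src _ _
  have (a : Abelian.Ext (ModuleCat.of A N) (ModuleCat.of A M) i) : a = 0 := by
    rw [← a.comp_mk₀_id, h0, Abelian.Ext.mk₀_zero, Abelian.Ext.comp_zero]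
  exact ⟨fun a b => (this a).trans (this b).symm⟩

lemma ExtVanishes.of_colon {K P : Ideal A} {u : A} {t : ℕ} (h : ∀ p, u * p ∈ K ↔ p ∈ P)
    (hP : ExtVanishes (A := A) N (A ⧸ P) t)
    (hL : ExtVanishes (A := A) N (A ⧸ K ⊔ Ideal.span {u}) t) :
    ExtVanishes (A := A) N (A ⧸ K) t :=
  .middle (colonMap_injective h) (colonMap_exact_supMap h) supMap_surjective hP hL

lemma ExtVanishes.sup_span_singleton {K : Ideal A} {u : A} {t : ℕ} (h : ∀ p, u * p ∈ K ↔ p ∈ K)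
    (hK : ExtVanishes (A := A) N (A ⧸ K) (t + 1)) :
    ExtVanishes (A := A) N (A ⧸ K ⊔ Ideal.span {u}) t :=
  .right (colonMap_injective h) (colonMap_exact_supMap h) supMap_surjective hK hK

lemma ExtVanishes.congr {M M' : Type} [AddCommGroup M] [AddCommGroup M'] [Module A M]
    [Module A M'] (e : M ≃ₗ[A] M') {t : ℕ} (h : ExtVanishes (A := A) N M t) :
    ExtVanishes (A := A) N M' t :=
  .middle (g := (0 : M' →ₗ[A] PUnit)) e.injective
    (fun x => ⟨fun _ => e.surjective x, fun _ => rfl⟩) (fun _ => ⟨0, rfl⟩) h (.of_subsingleton _ _)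

lemma SubsetsRegular.extVanishes {s c t : ℕ} {f : Fin s → A} (h : SubsetsRegular f (c + 1))
    (hA : ExtVanishes (A := A) N A t) (T : Finset (Fin s)) (hT : T.card ≤ c) :
    ExtVanishes (A := A) N (A ⧸ Ideal.span (f '' ↑T)) (t - T.card) := by
  induction T using Finset.induction_on with
  | empty => exact hA.congr (Submodule.quotEquivOfEqBot (Ideal.span (f '' ↑(∅ : Finset (Fin s))))
      (by simp)).symm
  | insert j T hj ih =>
    rw [Finset.card_insert_of_notMem hj] at hT ⊢
    rw [span_image_insert]
    intro i hi
    refine ExtVanishes.sup_span_singleton (t := t - (T.card + 1)) (fun p => ⟨fun hp => ?_,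
      Ideal.mul_mem_left _ _⟩) (fun i hi => ih (by omega) i (by omega)) i hi
    exact h.mem_of_mul_mem hj (by omega) hp

lemma support_quotient_eq_zeroLocus (J : Ideal A) :
    Module.support A (A ⧸ J) = PrimeSpectrum.zeroLocus (J : Set A) := by
  rw [Module.support_eq_zeroLocus, Ideal.annihilator_quotient]

variable [IsNoetherianRing A] {J : Ideal A} {M : Type} [AddCommGroup M] [Module A M]
  [Module.Finite A M]

lemma extVanishes_of_isRegular (hJ : J • (⊤ : Submodule A M) < ⊤) {rs : List A}
    (hreg : RingTheory.Sequence.IsRegular M rs) (hmem : ∀ r ∈ rs, r ∈ J) :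
    ExtVanishes (A := A) (A ⧸ J) M rs.length :=
  ModuleCat.subsingleton_ext_of_exists_isRegular J (ModuleCat.of A (A ⧸ J))
    (support_quotient_eq_zeroLocus J).le (ModuleCat.of A M) hJ rs hmem hreg

lemma exists_isRegular_of_extVanishes (hJ : J • (⊤ : Submodule A M) < ⊤) {t : ℕ}
    (h : ExtVanishes (A := A) (A ⧸ J) M t) :
    ∃ rs : List A, rs.length = t ∧ (∀ r ∈ rs, r ∈ J) ∧ RingTheory.Sequence.IsRegular M rs :=
  ModuleCat.exists_isRegular_of_exists_subsingleton_ext J t (ModuleCat.of A M) hJ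
    (ModuleCat.of A (A ⧸ J)) (support_quotient_eq_zeroLocus J) h

end ExtVanishing

section Dimension

open Module RingTheory.Sequence

lemma supportDim_quotient_add_length_le {A : Type*} [CommRing A] [IsNoetherianRing A]
    (rs : List A) (M : Type*) [AddCommGroup M] [Module A M] [Module.Finite A M]
    (h : IsWeaklyRegular M rs) :
    supportDim A (M ⧸ (Ideal.ofList rs • ⊤ : Submodule A M)) + rs.length ≤ supportDim A M := by
  induction rs generalizing M with
  | nil =>
    rw [List.length_nil, Nat.cast_zero, add_zero]
    exact supportDim_le_of_surjective _ (Submodule.mkQ_surjective _)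
  | cons r rs ih =>
    rw [isWeaklyRegular_cons_iff] at h
    rw [supportDim_eq_of_equiv (Submodule.quotOfListConsSMulTopEquivQuotSMulTopInner M r rs),
      List.length_cons, Nat.cast_add, ← add_assoc, Nat.cast_one]
    grw [ih _ h.2]
    exact supportDim_quotSMulTop_succ_le_of_notMem_minimalPrimes
      fun _ => h.1.notMem_of_mem_minimalPrimes

lemma length_le_ringKrullDim_quotient {A : Type*} [CommRing A] [IsNoetherianRing A] {I : Ideal A}
    {rs : List A} (h : IsRegular (A ⧸ I) rs) : (rs.length : WithBot ℕ∞) ≤ ringKrullDim (A ⧸ I) := by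
  rw [← supportDim_quotient_eq_ringKrullDim]
  refine le_trans ?_ (supportDim_quotient_add_length_le rs _ h.1)
  have : Nontrivial ((A ⧸ I) ⧸ (Ideal.ofList rs • ⊤ : Submodule A (A ⧸ I))) :=
    Submodule.Quotient.nontrivial_iff.2 h.top_ne_smul.symm
  have h0 : 0 ≤ supportDim A ((A ⧸ I) ⧸ (Ideal.ofList rs • ⊤ : Submodule A (A ⧸ I))) := by
    have := nonempty_support_of_nontrivial (R := A)
      (M := (A ⧸ I) ⧸ (Ideal.ofList rs • ⊤ : Submodule A (A ⧸ I)))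
    have := this.to_subtype
    exact Order.krullDim_nonneg
  simpa using add_le_add_left h0 (rs.length : WithBot ℕ∞)

lemma idealDepth_le_ringKrullDim {A : Type*} [CommRing A] [IsNoetherianRing A] (J : Ideal A)
    {I : Ideal A} (hI : I ≠ ⊤) : (idealDepth J (A ⧸ I) : WithBot ℕ∞) ≤ ringKrullDim (A ⧸ I) := by
  have := Ideal.Quotient.nontrivial_iff.2 hI
  obtain ⟨d, hd⟩ := WithBot.ne_bot_iff_exists.1
    ((WithBot.bot_lt_coe 0).trans_le (ringKrullDim_nonneg_of_nontrivial (R := A ⧸ I))).ne'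
  rw [← hd, WithBot.coe_le_coe]
  refine sSup_le ?_
  rintro _ ⟨rs, rfl, -, hrs⟩
  have := length_le_ringKrullDim_quotient hrs
  rw [← hd] at this
  exact_mod_cast this

lemma ringKrullDim_quotient_le_of_forall_prime {A : Type*} [CommRing A] {I : Ideal A}
    {d : WithBot ℕ∞}
    (h : ∀ p : Ideal A, p.IsPrime → I ≤ p → ∃ J ≤ p, ringKrullDim (A ⧸ J) ≤ d) :
    ringKrullDim (A ⧸ I) ≤ d := by
  rw [ringKrullDim_quotient, Order.krullDim]
  refine iSup_le fun l => ?_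
  obtain ⟨J, hJ, hd⟩ := h l.head.1.asIdeal l.head.1.2 l.head.2
  refine le_trans ?_ hd
  rw [ringKrullDim_quotient]
  have hmem (i : Fin (l.length + 1)) : (l i).1 ∈ PrimeSpectrum.zeroLocus (J : Set A) :=
    fun x hx => (l.monotone (Fin.zero_le i) : l.head.1 ≤ (l i).1) (hJ hx)
  exact Order.LTSeries.length_le_krullDim
    (⟨l.length, fun i => ⟨(l i).1, hmem i⟩, fun i => l.step i⟩ :
      LTSeries (PrimeSpectrum.zeroLocus (J : Set A)))

end Dimension

section PolynomialRing

variable {k : Type} [Field k]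

lemma mem_irrelevantIdeal {σ : Type} {p : MvPolynomial σ k} :
    p ∈ irrelevantIdeal k σ ↔ constantCoeff p = 0 := by
  have := mem_pow_idealOfVars_iff' (σ := σ) 1 p
  rw [pow_one] at this
  rw [irrelevantIdeal, this, constantCoeff_eq]
  simp [Finsupp.degree_eq_zero_iff]

lemma irrelevantIdeal_ne_top {σ : Type} : irrelevantIdeal k σ ≠ ⊤ := by
  rw [Ideal.ne_top_iff_one, mem_irrelevantIdeal]
  simp

lemma MvPolynomial.IsHomogeneous.mem_irrelevantIdeal {σ : Type} {p : MvPolynomial σ k} {d : ℕ}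
    (hp : p.IsHomogeneous d) (hu : ¬ IsUnit p) : p ∈ irrelevantIdeal k σ := by
  rw [_root_.mem_irrelevantIdeal, constantCoeff_eq]
  by_contra h
  have hd : d = 0 := by simpa using (hp h).symm
  subst hd
  rw [totalDegree_eq_zero_iff_eq_C.1 (Nat.le_zero.1 hp.totalDegree_le)] at hu
  exact hu ((Ne.isUnit h).map C)

lemma SubsetsRegular.mem_irrelevantIdeal {σ : Type} {s c : ℕ} {f : Fin s → MvPolynomial σ k}
    {d : Fin s → ℕ} (hdeg : ∀ i, (f i).IsHomogeneous (d i)) (h : SubsetsRegular f (c + 1))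
    (i : Fin s) : f i ∈ irrelevantIdeal k σ := by
  refine (hdeg i).mem_irrelevantIdeal fun hu => ?_
  refine (h [i] (by simp) (by simp)).top_ne_smul ?_
  rw [List.map_singleton, Ideal.ofList_singleton, Ideal.span_singleton_eq_top.2 hu,
    Submodule.top_smul]

lemma isRegular_map_X {s : ℕ} {l : List (Fin s)} (hl : l.Nodup) :
    RingTheory.Sequence.IsRegular (MvPolynomial (Fin s) k)
      (l.map (X : Fin s → MvPolynomial (Fin s) k)) := by
  refine ⟨?_, ?_⟩
  · induction l using List.reverseRecOn with
    | nil => exact .nil _ _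
    | append_singleton l j ih =>
      rw [List.nodup_append] at hl
      have hj : j ∉ l.toFinset := fun hj => hl.2.2 j (List.mem_toFinset.1 hj) j (by simp) rfl
      rw [List.map_append, RingTheory.Sequence.isWeaklyRegular_append_iff, List.map_singleton,
        RingTheory.Sequence.isWeaklyRegular_singleton_iff]
      refine ⟨ih hl.1, ?_⟩
      rw [ofList_map_smul_top, isSMulRegular_iff_right_eq_zero_of_smul]
      intro x hx
      obtain ⟨p, rfl⟩ := Submodule.Quotient.mk_surjective _ x
      rw [← Submodule.Quotient.mk_smul, Submodule.Quotient.mk_eq_zero] at hx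
      rw [Submodule.Quotient.mk_eq_zero]
      exact (X_mul_mem_span_X_image_iff hj p).1 hx
  · rw [smul_eq_mul, Ideal.mul_top]
    refine (ne_top_of_le_ne_top (irrelevantIdeal_ne_top (k := k) (σ := Fin s)) ?_).symm
    refine Ideal.span_mono fun x hx => ?_
    obtain ⟨i, -, rfl⟩ := List.mem_map.1 hx
    exact ⟨i, rfl⟩

lemma irrelevantIdeal_smul_top_lt {σ : Type} {I : Ideal (MvPolynomial σ k)}
    (hI : I ≤ irrelevantIdeal k σ) :
    irrelevantIdeal k σ • (⊤ : Submodule (MvPolynomial σ k) (MvPolynomial σ k ⧸ I)) < ⊤ := by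
  have hle : irrelevantIdeal k σ • (⊤ : Submodule (MvPolynomial σ k) (MvPolynomial σ k ⧸ I)) ≤
      LinearMap.ker (Submodule.factor hI) := by
    rw [Submodule.smul_le]
    intro r hr x _
    obtain ⟨p, rfl⟩ := Ideal.Quotient.mk_surjective x
    exact Ideal.Quotient.eq_zero_iff_mem.2 (Ideal.mul_mem_right p _ hr)
  refine hle.trans_lt (lt_top_iff_ne_top.2 fun h => irrelevantIdeal_ne_top (k := k) (σ := σ) ?_)
  rw [Ideal.eq_top_iff_one, ← Ideal.Quotient.eq_zero_iff_mem]
  exact LinearMap.mem_ker.1 (h ▸ Submodule.mem_top : Ideal.Quotient.mk I 1 ∈ LinearMap.ker _)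

lemma extVanishes_mvPolynomial (s : ℕ) :
    ExtVanishes (A := MvPolynomial (Fin s) k)
      (MvPolynomial (Fin s) k ⧸ irrelevantIdeal k (Fin s)) (MvPolynomial (Fin s) k) s := by
  have := extVanishes_of_isRegular (J := irrelevantIdeal k (Fin s)) ?_
    (isRegular_map_X (k := k) (List.nodup_finRange s)) ?_
  · simpa using this
  · rw [smul_eq_mul, Ideal.mul_top]
    exact irrelevantIdeal_ne_top.lt_top
  · intro r hr
    obtain ⟨i, -, rfl⟩ := List.mem_map.1 hr
    exact Ideal.subset_span ⟨i, rfl⟩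

lemma isCMQuotient_of_extVanishes {s t : ℕ} {I : Ideal (MvPolynomial (Fin s) k)}
    (hI : I ≤ irrelevantIdeal k (Fin s))
    (hext : ExtVanishes (A := MvPolynomial (Fin s) k)
      (MvPolynomial (Fin s) k ⧸ irrelevantIdeal k (Fin s)) (MvPolynomial (Fin s) k ⧸ I) t)
    (hdim : ringKrullDim (MvPolynomial (Fin s) k ⧸ I) ≤ t) : IsCMQuotient I := by
  refine le_antisymm (idealDepth_le_ringKrullDim _
    (ne_top_of_le_ne_top irrelevantIdeal_ne_top hI)) (hdim.trans ?_)
  obtain ⟨rs, hlen, hmem, hreg⟩ :=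
    exists_isRegular_of_extVanishes (irrelevantIdeal_smul_top_lt hI) hext
  have : (t : ℕ∞) ≤ idealDepth (irrelevantIdeal k (Fin s)) (MvPolynomial (Fin s) k ⧸ I) :=
    le_sSup ⟨rs, by rw [hlen], hmem, hreg⟩
  exact_mod_cast this

lemma SubsetsRegular.ringKrullDim_quotient_le {N s c : ℕ} {f : Fin s → MvPolynomial (Fin N) k}
    (h : SubsetsRegular f (c + 1)) {T : Finset (Fin s)} (hT : T.card = c) (hc : c ≤ N) :
    ringKrullDim (MvPolynomial (Fin N) k ⧸ Ideal.span (f '' ↑T)) ≤ (N - c : ℕ) := by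
  have hreg := supportDim_quotient_add_length_le (T.toList.map f) (MvPolynomial (Fin N) k)
    (h T.toList T.nodup_toList (by simp [hT])).1
  rw [ofList_map_smul_top, Finset.toList_toFinset, Module.supportDim_quotient_eq_ringKrullDim,
    Module.supportDim_self_eq_ringKrullDim,
    MvPolynomial.ringKrullDim_of_isNoetherianRing, ringKrullDim_eq_zero_of_field, zero_add,
    Nat.card_eq_fintype_card, Fintype.card_fin, List.length_map, Finset.length_toList, hT] at hreg
  obtain ⟨e, rfl⟩ := Nat.exists_eq_add_of_le' hc
  rw [Nat.add_sub_cancel]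
  revert hreg
  generalize ringKrullDim (MvPolynomial (Fin (e + c)) k ⧸ Ideal.span (f '' ↑T)) = x
  intro hreg
  induction x using WithBot.recBotCoe with
  | bot => exact bot_le
  | coe x =>
    have h2 : x + (c : ℕ∞) ≤ e + c := by exact_mod_cast hreg
    exact_mod_cast (ENat.add_le_add_iff_right (ENat.natCast_ne_top c)).1 h2

end PolynomialRing

section Betti

lemma torRank_congr {k A M N M' N' : Type} [Field k] [CommRing A] [Algebra k A] [AddCommGroup M]
    [Module A M] [AddCommGroup N] [Module A N] [AddCommGroup M'] [Module A M'] [AddCommGroup N']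
    [Module A N'] (e : M ≃ₗ[A] M') (e' : N ≃ₗ[A] N') (i : ℕ) :
    torRank k A M N i = torRank k A M' N' i :=
  torRank_eq_rank_of_iso (((Tor (ModuleCat A) i).mapIso e.toModuleIso).app _ ≪≫
    ((Tor (ModuleCat A) i).obj (ModuleCat.of A M')).mapIso e'.toModuleIso)

variable {k σ τ : Type} [Field k] [Algebra (MvPolynomial σ k) (MvPolynomial τ k)]
  [IsScalarTower k (MvPolynomial σ k) (MvPolynomial τ k)]

lemma constantCoeff_algebraMap
    (h : ∀ i, algebraMap (MvPolynomial σ k) (MvPolynomial τ k) (X i) ∈ irrelevantIdeal k τ)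
    (p : MvPolynomial σ k) :
    constantCoeff (algebraMap (MvPolynomial σ k) (MvPolynomial τ k) p) = constantCoeff p := by
  induction p using MvPolynomial.induction_on with
  | C a =>
    have : algebraMap (MvPolynomial σ k) (MvPolynomial τ k) (C a) = C a :=
      (IsScalarTower.algebraMap_apply k (MvPolynomial σ k) (MvPolynomial τ k) a).symm
    rw [this, constantCoeff_C, constantCoeff_C]
  | add p q hp hq => simp only [map_add, hp, hq]
  | mul_X p i hp =>
    simp only [map_mul, constantCoeff_X, mul_zero, mem_irrelevantIdeal.1 (h i)]

/-- The residue field of a polynomial ring at the origin does not change along a map preserving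
the origin. -/
lemma nonempty_residue_equiv
    (h : ∀ i, algebraMap (MvPolynomial σ k) (MvPolynomial τ k) (X i) ∈ irrelevantIdeal k τ) :
    Nonempty ((MvPolynomial σ k ⧸ irrelevantIdeal k σ) ≃ₗ[MvPolynomial σ k]
      MvPolynomial τ k ⧸ irrelevantIdeal k τ) := by
  let π : MvPolynomial σ k →ₗ[MvPolynomial σ k] MvPolynomial τ k ⧸ irrelevantIdeal k τ :=
    (Algebra.linearMap (MvPolynomial σ k) (MvPolynomial τ k ⧸ irrelevantIdeal k τ))
  have hπ (p : MvPolynomial σ k) :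
      π p = Ideal.Quotient.mk _ (algebraMap (MvPolynomial σ k) (MvPolynomial τ k) p) := rfl
  have hker : irrelevantIdeal k σ = LinearMap.ker π := by
    ext p
    rw [LinearMap.mem_ker, hπ, Ideal.Quotient.eq_zero_iff_mem, mem_irrelevantIdeal,
      mem_irrelevantIdeal, constantCoeff_algebraMap h]
  refine ⟨(Submodule.quotEquivOfEq _ _ hker).trans (π.quotKerEquivOfSurjective fun x => ?_)⟩
  obtain ⟨r, rfl⟩ := Ideal.Quotient.mk_surjective x
  refine ⟨C (constantCoeff r), ?_⟩
  rw [hπ, Ideal.Quotient.mk_eq_mk_iff_sub_mem, mem_irrelevantIdeal, map_sub,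
    constantCoeff_algebraMap h, constantCoeff_C, sub_self]

theorem bettiNum_map
    (h : ∀ i, algebraMap (MvPolynomial σ k) (MvPolynomial τ k) (X i) ∈ irrelevantIdeal k τ)
    {I : Ideal (MvPolynomial σ k)}
    (hI : TorAcyclic (ModuleCat.of (MvPolynomial σ k) (MvPolynomial σ k ⧸ I))
      (ModuleCat.of (MvPolynomial σ k) (MvPolynomial τ k))) (i : ℕ) :
    bettiNum k (I.map (algebraMap (MvPolynomial σ k) (MvPolynomial τ k))) i = bettiNum k I i := by
  obtain ⟨e⟩ := nonempty_residue_equiv h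
  rw [bettiNum, bettiNum, torRank_congr (LinearEquiv.refl _ _) e,
    ← torRank_baseChange (R := MvPolynomial τ k) i _ hI]
  exact torRank_congr
    (Algebra.TensorProduct.quotIdealMapEquivTensorQuot (MvPolynomial τ k) I).toLinearEquiv
    (LinearEquiv.refl _ _) i

end Betti

section Specialization

variable {k : Type} [Field k] {s c m : ℕ} {B : Finset (Finset (Fin s))}

/-- A power of the product of the variables outside `T` moves `P_T ^ m` into the intersection of
the ideals `P_T' ^ m`, `T' ∈ B`. -/
lemma prod_compl_pow_mul_mem_iInf (hcard : ∀ T ∈ B, T.card = c) {T : Finset (Fin s)} (hT : T ∈ B)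
    {p : MvPolynomial (Fin s) k}
    (hp : p ∈ Ideal.span ((X : Fin s → MvPolynomial (Fin s) k) '' ↑T) ^ m) :
    (∏ i ∈ Tᶜ, X i) ^ m * p ∈
      ⨅ T ∈ B, Ideal.span ((X : Fin s → MvPolynomial (Fin s) k) '' ↑T) ^ m := by
  simp only [Ideal.mem_iInf]
  intro T' hT'
  by_cases hTT' : T' ⊆ T
  · rw [Finset.eq_of_subset_of_card_le hTT' (by rw [hcard T hT, hcard T' hT'])]
    exact Ideal.mul_mem_left _ _ hp
  · obtain ⟨j, hj, hjT⟩ := Finset.not_subset.1 hTT'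
    refine Ideal.mul_mem_right _ _ (Ideal.pow_mem_pow ?_ m)
    rw [← Finset.mul_prod_erase _ _ (Finset.mem_compl.2 hjT)]
    exact Ideal.mul_mem_right _ _ (Ideal.subset_span ⟨j, hj, rfl⟩)

variable {R : Type} [CommRing R] [Algebra (MvPolynomial (Fin s) k) R]

lemma map_span_X_image_pow (T : Finset (Fin s)) (m : ℕ) :
    (Ideal.span ((X : Fin s → MvPolynomial (Fin s) k) '' ↑T) ^ m).map
      (algebraMap (MvPolynomial (Fin s) k) R) =
      Ideal.span ((fun i => algebraMap (MvPolynomial (Fin s) k) R (X i)) '' ↑T) ^ m := by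
  rw [Ideal.map_pow, map_span_X_image]

/-- The homological properties of the extension of an intersection of powers of monomial primes
along a map sending the variables to elements any `c + 1` of which form a regular sequence. -/
lemma SubsetsRegular.torAcyclic_saturatedMap_extVanishes
    (h : SubsetsRegular (fun i => algebraMap (MvPolynomial (Fin s) k) R (X i)) (c + 1))
    (hne : B.Nonempty) (hB : SymmExchange B) (hcard : ∀ T ∈ B, T.card = c) (m : ℕ)
    {N : Type} [AddCommGroup N] [Module R N] {t : ℕ} (hR : ExtVanishes (A := R) N R t)
    {I : Ideal (MvPolynomial (Fin s) k)}
    (hI : I = ⨅ T ∈ B, Ideal.span ((X : Fin s → MvPolynomial (Fin s) k) '' ↑T) ^ m) :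
    TorAcyclic (ModuleCat.of (MvPolynomial (Fin s) k) (MvPolynomial (Fin s) k ⧸ I))
        (ModuleCat.of (MvPolynomial (Fin s) k) R) ∧
      SaturatedMap R ((fun T => (∏ i ∈ Tᶜ, X i) ^ m) '' (B : Set (Finset (Fin s)))) I ∧
      ExtVanishes (A := R) N (R ⧸ I.map (algebraMap (MvPolynomial (Fin s) k) R)) (t - c) := by
  subst hI
  refine iInf_span_X_image_pow_induction
    (Q := fun I => TorAcyclic (ModuleCat.of (MvPolynomial (Fin s) k) (MvPolynomial (Fin s) k ⧸ I))
        (ModuleCat.of (MvPolynomial (Fin s) k) R) ∧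
      SaturatedMap R ((fun T => (∏ i ∈ Tᶜ, X i) ^ m) '' (B : Set (Finset (Fin s)))) I ∧
      ExtVanishes (A := R) N (R ⧸ I.map (algebraMap (MvPolynomial (Fin s) k) R)) (t - c))
    hne hB hcard m ⟨?_, ?_, ?_⟩ ?_
  · have : Subsingleton (MvPolynomial (Fin s) k ⧸ (⊤ : Ideal (MvPolynomial (Fin s) k))) :=
      Ideal.Quotient.subsingleton_iff.2 rfl
    have : Module.Flat (MvPolynomial (Fin s) k)
      (MvPolynomial (Fin s) k ⧸ (⊤ : Ideal (MvPolynomial (Fin s) k))) := inferInstance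
    exact torAcyclic_of_flat _ _
  · intro r _
    rw [Ideal.map_top]
    exact Submodule.mem_top
  · have : Subsingleton (R ⧸ (⊤ : Ideal (MvPolynomial (Fin s) k)).map (algebraMap _ R)) :=
      Ideal.Quotient.subsingleton_iff.2 (Ideal.map_top _)
    exact .of_subsingleton _ _
  · rintro T hT K u hu ⟨hTor, hSat, hExt⟩
    refine ⟨.of_colon hu (h.torAcyclic T (hcard T hT).le) hTor, .of_colon hu hTor ?_ hSat,
      .of_colon (hTor.mul_mem_map_iff hu) ?_ ?_⟩
    · intro r hr
      refine h.mem_of_prod_pow_mul_mem (hcard T hT).le m ?_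
      rw [← map_pow]
      exact hr _ ⟨T, hT, rfl⟩
    · rw [map_span_X_image, ← hcard T hT]
      exact h.extVanishes hR T (hcard T hT).le
    · rwa [Ideal.map_sup, Ideal.map_span, Set.image_singleton] at hExt

lemma iInf_span_image_pow_eq_map (hcard : ∀ T ∈ B, T.card = c)
    {I : Ideal (MvPolynomial (Fin s) k)}
    (hI : I = ⨅ T ∈ B, Ideal.span ((X : Fin s → MvPolynomial (Fin s) k) '' ↑T) ^ m)
    (hsat : SaturatedMap R ((fun T => (∏ i ∈ Tᶜ, X i) ^ m) '' (B : Set (Finset (Fin s)))) I) :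
    ⨅ T ∈ B, Ideal.span ((fun i => algebraMap (MvPolynomial (Fin s) k) R (X i)) '' ↑T) ^ m =
      I.map (algebraMap (MvPolynomial (Fin s) k) R) := by
  apply le_antisymm
  · intro r hr
    apply hsat
    rintro _ ⟨T, hT, rfl⟩
    simp only [Ideal.mem_iInf] at hr
    have hrT := hr T hT
    rw [← map_span_X_image_pow] at hrT
    have hle : Ideal.span {(∏ i ∈ Tᶜ, (X i : MvPolynomial (Fin s) k)) ^ m} *
        Ideal.span ((X : Fin s → MvPolynomial (Fin s) k) '' ↑T) ^ m ≤ I := by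
      rw [Ideal.span_singleton_mul_le_iff, hI]
      exact fun p hp => prod_compl_pow_mul_mem_iInf hcard hT hp
    have := Ideal.map_mono (f := algebraMap (MvPolynomial (Fin s) k) R) hle
    rw [Ideal.map_mul, Ideal.map_span, Set.image_singleton,
      Ideal.span_singleton_mul_le_iff] at this
    exact this r hrT
  · refine le_iInf₂ fun T hT => ?_
    rw [← map_span_X_image_pow, hI]
    exact Ideal.map_mono (iInf₂_le T hT)

end Specialization

section Configuration

variable {s : ℕ} {Δ : Finset (Fin s) → Prop}

lemma iInf_isBasisOf_eq_iInf_cobases {α : Type*} [CompleteLattice α] (g : Finset (Fin s) → α) :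
    ⨅ F ∈ {F : Finset (Fin s) | IsBasisOf Δ F}, g Fᶜ = ⨅ T ∈ cobases Δ, g T := by
  apply le_antisymm
  · refine le_iInf₂ fun T hT => ?_
    refine (iInf₂_le Tᶜ (mem_cobases.1 hT)).trans ?_
    rw [compl_compl]
  · refine le_iInf₂ fun F hF => iInf₂_le Fᶜ (mem_cobases.2 ?_)
    rw [compl_compl]
    exact hF

lemma ringKrullDim_quotient_iInf_pow_le {A ι : Type*} [CommRing A] {B : Finset ι} {J : ι → Ideal A}
    {m : ℕ} {d : WithBot ℕ∞} (h : ∀ T ∈ B, ringKrullDim (A ⧸ J T) ≤ d) :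
    ringKrullDim (A ⧸ ⨅ T ∈ B, J T ^ m) ≤ d := by
  refine ringKrullDim_quotient_le_of_forall_prime fun p hp hle => ?_
  rw [← Finset.inf_eq_iInf, hp.inf_le'] at hle
  obtain ⟨T, hT, hTp⟩ := hle
  exact ⟨J T, hp.le_of_pow_le hTp, h T hT⟩

end Configuration

theorem statement13 (k : Type) [Field k] [Infinite k] (s c n : ℕ) (hcs : c ≤ s) (hcn : c ≤ n)
    (Δ : Finset (Fin s) → Prop) (hmat : IsMatroid Δ)
    (hdim : ∀ F, IsBasisOf Δ F → F.card = s - c)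
    (f : Fin s → MvPolynomial (Fin (n + 1)) k) (d : Fin s → ℕ)
    (hdeg : ∀ i, (f i).IsHomogeneous (d i))
    (hreg : SubsetsRegular f (c + 1))
    (m : ℕ) (hm : 0 < m) :
    IsCMQuotient (⨅ F ∈ {F : Finset (Fin s) | IsBasisOf Δ F},
        (Ideal.span (f '' ↑(Fᶜ))) ^ m) ∧
      ∀ i : ℕ,
        bettiNum k (⨅ F ∈ {F : Finset (Fin s) | IsBasisOf Δ F},
            (Ideal.span (f '' ↑(Fᶜ))) ^ m) i
          = bettiNum k (⨅ F ∈ {F : Finset (Fin s) | IsBasisOf Δ F},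
              (Ideal.span ((X : Fin s → MvPolynomial (Fin s) k) '' ↑(Fᶜ))) ^ m) i := by
  rw [iInf_isBasisOf_eq_iInf_cobases fun T : Finset (Fin s) => Ideal.span (f '' ↑T) ^ m,
    iInf_isBasisOf_eq_iInf_cobases fun T : Finset (Fin s) =>
      Ideal.span ((X : Fin s → MvPolynomial (Fin s) k) '' ↑T) ^ m]
  have hcard : ∀ T ∈ cobases Δ, T.card = c := fun T hT => by
    have h1 := hdim _ (mem_cobases.1 hT)
    have h2 := T.card_add_card_compl
    rw [Fintype.card_fin] at h2
    omega
  let : Algebra (MvPolynomial (Fin s) k) (MvPolynomial (Fin (n + 1)) k) := (aeval f).toAlgebra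
  have : IsScalarTower k (MvPolynomial (Fin s) k) (MvPolynomial (Fin (n + 1)) k) :=
    IsScalarTower.of_algebraMap_eq' (aeval f).comp_algebraMap.symm
  have hX (i : Fin s) : algebraMap (MvPolynomial (Fin s) k) (MvPolynomial (Fin (n + 1)) k) (X i) =
    f i := aeval_X f i
  have hf : f = fun i =>
    algebraMap (MvPolynomial (Fin s) k) (MvPolynomial (Fin (n + 1)) k) (X i) := (funext hX).symm
  have hmem := SubsetsRegular.mem_irrelevantIdeal hdeg hreg
  obtain ⟨hTor, hsat, hExt⟩ := SubsetsRegular.torAcyclic_saturatedMap_extVanishes (hf ▸ hreg)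
    hmat.cobases_nonempty hmat.symmExchange_cobases hcard m (extVanishes_mvPolynomial (n + 1)) rfl
  have hmap := iInf_span_image_pow_eq_map hcard rfl hsat
  rw [← hf] at hmap
  refine ⟨isCMQuotient_of_extVanishes (t := n + 1 - c) ?_ ?_ ?_, fun i => ?_⟩
  · obtain ⟨T, hT⟩ := hmat.cobases_nonempty
    refine (iInf₂_le T hT).trans ((Ideal.pow_le_self hm.ne').trans (Ideal.span_le.2 ?_))
    rintro _ ⟨i, -, rfl⟩
    exact hmem i
  · rwa [hmap]
  · exact ringKrullDim_quotient_iInf_pow_le fun T hT =>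
      hreg.ringKrullDim_quotient_le (hcard T hT) (by omega)
  · rw [hmap]
    exact bettiNum_map (fun i => by rw [hX]; exact hmem i) hTor i
end
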